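/- arXiv:1111.3885 — 2 statements merged into one kernel-verified Lean document; each statement's English description precedes it below -/
import Mathlib

section
/- Let (Ω, F, (F_t)_{t≥0}, P) be a filtered probability space with right-continuous filtration, and let 𝒴 be a fork-convex family of adapted, nonnegative, right-continuous processes containing the constant process 1 and such that Y₀ = 1 for all Y ∈ 𝒴. Let 𝒦 = { lim_{t→∞} Y_t : Y ∈ 𝒴 and the almost sure limit exists }. Then 𝒦 is bounded in probability if and only if there exists a supermartingale density for 𝒴. -/
open MeasureTheory Filter Set
open scoped ENNReal NNReal Topology

namespace Rokhlin

open Classical in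
/-- number of upcrossings along a list of times; the flag says whether we are waiting for
a value at least `b` (`true`) or at most `a` (`false`). -/
noncomputable def upc (a b : ℝ≥0∞) (x : ℝ≥0 → ℝ≥0∞) : Bool → List ℝ≥0 → ℕ
  | _, [] => 0
  | true, t :: l => if b ≤ x t then upc a b x false l + 1 else upc a b x true l
  | false, t :: l => if x t ≤ a then upc a b x true l else upc a b x false l

lemma upc_compare {a b : ℝ≥0∞} (hab : a < b) (x : ℝ≥0 → ℝ≥0∞) (l : List ℝ≥0) :
    upc a b x false l ≤ upc a b x true l ∧ upc a b x true l ≤ upc a b x false l + 1 := by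
  induction l with
  | nil => simp [upc]
  | cons t l ih =>
    simp only [upc]
    by_cases h1 : b ≤ x t
    · have h2 : ¬ x t ≤ a := not_le.2 (hab.trans_le h1)
      simp [h1, h2]
    · by_cases h2 : x t ≤ a
      · simp [h1, h2]
      · simp [h1, h2, ih]

lemma upc_sublist {a b : ℝ≥0∞} (hab : a < b) (x : ℝ≥0 → ℝ≥0∞) {l l' : List ℝ≥0}
    (h : l.Sublist l') : ∀ q, upc a b x q l ≤ upc a b x q l' := by
  induction h with
  | slnil => simp
  | @cons l l' t h ih =>
    have hc := upc_compare hab x l'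
    intro q
    refine (ih q).trans ?_
    cases q <;> simp only [upc] <;> split_ifs <;> omega
  | @cons_cons l l' t h ih =>
    have h1 := ih true
    have h2 := ih false
    intro q
    cases q <;> simp only [upc] <;> split_ifs <;> omega

lemma upc_append {a b : ℝ≥0∞} (hab : a < b) (x : ℝ≥0 → ℝ≥0∞) {s t : ℝ≥0}
    (hs : x s ≤ a) (ht : b ≤ x t) (l : List ℝ≥0) :
    ∀ q, upc a b x q l + 1 ≤ upc a b x q (l ++ [s, t]) := by
  have hs' : ¬ b ≤ x s := not_le.2 (hs.trans_lt hab)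
  induction l with
  | nil => intro q; cases q <;> simp [upc, hs, ht, hs']
  | cons u l ih =>
    have h1 := ih true
    have h2 := ih false
    intro q
    cases q <;> simp only [upc, List.cons_append] <;> split_ifs <;> omega

lemma upc_cons {a b : ℝ≥0∞} (x : ℝ≥0 → ℝ≥0∞) {s t : ℝ≥0}
    (hs : x s ≤ a) (ht : b ≤ x t) (l : List ℝ≥0) :
    upc a b x false (s :: t :: l) = upc a b x false l + 1 := by
  simp [upc, hs, ht]

section prob
variable {Ω : Type*} {m : MeasurableSpace Ω} {P : Measure Ω} {ℱ : Filtration ℝ≥0 m}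
  {L : ℝ≥0 → Ω → ℝ≥0∞}

lemma upc_meas (hL : ∀ t, 0 < t → Measurable[ℱ t] (L t)) (a b : ℝ≥0∞) (l : List ℝ≥0)
    (hl : ∀ t ∈ l, 0 < t) : ∀ q,
    Measurable (fun ω => (upc a b (fun t => L t ω) q l : ℝ≥0∞)) := by
  induction l with
  | nil => intro q; simp [upc]
  | cons t l ih =>
    have h1 := ih (fun u hu => hl u (by simp [hu]))
    have hm : Measurable (L t) := (hL t (hl t (by simp))).mono (ℱ.le t) le_rfl
    intro q
    cases q
    · simp only [upc, Nat.cast_ite]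
      exact Measurable.ite (measurableSet_le hm measurable_const) (h1 _) (h1 _)
    · simp only [upc, Nat.cast_ite]
      refine Measurable.ite (measurableSet_le measurable_const hm) ?_ (h1 _)
      push_cast
      exact (h1 _).add measurable_const

lemma upc_bound (hL : ∀ t, 0 < t → Measurable[ℱ t] (L t))
    (hsup : ∀ s t, 0 < s → s < t → ∀ A, MeasurableSet[ℱ s] A →
      ∫⁻ ω in A, L t ω ∂P ≤ ∫⁻ ω in A, L s ω ∂P)
    (a c : ℝ≥0∞) (l : List ℝ≥0) (hl : l.Pairwise (· < ·)) :
    ∀ s, 0 < s → (∀ t ∈ l, s < t) → ∀ A, MeasurableSet[ℱ s] A →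
    (c * ∫⁻ ω in A, (upc a (a + c) (fun t => L t ω) true l : ℝ≥0∞) ∂P ≤ ∫⁻ ω in A, L s ω ∂P) ∧
    (c * ∫⁻ ω in A, (upc a (a + c) (fun t => L t ω) false l : ℝ≥0∞) ∂P ≤ a * P A) := by
  induction l with
  | nil => intro s hs _ A hA; simp [upc]
  | cons t l ih =>
    intro s hs hst A hA
    have hst' : s < t := hst t (by simp)
    have ht : 0 < t := hs.trans hst'
    rw [List.pairwise_cons] at hl
    have ih := ih hl.2 t ht hl.1
    have hmeas := upc_meas hL a (a + c) l (fun u hu => ht.trans (hl.1 u hu))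
    have hAt : MeasurableSet[ℱ t] A := ℱ.mono hst'.le _ hA
    have hB : MeasurableSet[ℱ t] {ω | a + c ≤ L t ω} :=
      @measurableSet_le _ _ _ _ _ (ℱ t) _ _ _ _ _ measurable_const (hL t ht)
    have hC : MeasurableSet[ℱ t] {ω | L t ω ≤ a} :=
      @measurableSet_le _ _ _ _ _ (ℱ t) _ _ _ _ _ (hL t ht) measurable_const
    have hB' := ℱ.le t _ hB
    have hC' := ℱ.le t _ hC
    constructor
    · refine le_trans ?_ (hsup s t hs hst' A hA)
      rw [← lintegral_inter_add_sdiff _ A hB', ← lintegral_inter_add_sdiff (L t) A hB', mul_add]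
      refine add_le_add ?_ ?_
      · have h1 := (ih (A ∩ {ω | a + c ≤ L t ω}) (hAt.inter hB)).2
        have e : ∫⁻ ω in A ∩ {ω | a + c ≤ L t ω},
            (upc a (a + c) (fun t => L t ω) true (t :: l) : ℝ≥0∞) ∂P
            = ∫⁻ ω in A ∩ {ω | a + c ≤ L t ω},
            ((upc a (a + c) (fun t => L t ω) false l : ℝ≥0∞) + 1) ∂P := by
          refine setLIntegral_congr_fun (ℱ.le t _ (hAt.inter hB)) ?_
          intro ω hω
          have : a + c ≤ L t ω := hω.2
          simp [upc, this]
        rw [e, lintegral_add_right _ measurable_const, mul_add]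
        calc _ ≤ a * P (A ∩ {ω | a + c ≤ L t ω}) + c * P (A ∩ {ω | a + c ≤ L t ω}) := by
              gcongr
              simp
          _ = ∫⁻ ω in A ∩ {ω | a + c ≤ L t ω}, (a + c) ∂P := by simp [add_mul]
          _ ≤ _ := setLIntegral_mono ((hL t ht).mono (ℱ.le t) le_rfl) (fun ω hω => hω.2)
      · have h1 := (ih (A \ {ω | a + c ≤ L t ω}) (hAt.diff hB)).1
        refine le_trans (le_of_eq ?_) h1
        congr 1
        refine setLIntegral_congr_fun (ℱ.le t _ (hAt.diff hB)) ?_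
        intro ω hω
        have : ¬ a + c ≤ L t ω := hω.2
        simp [upc, this]
    · rw [← lintegral_inter_add_sdiff _ A hC', mul_add, ← measure_inter_add_sdiff A hC', mul_add]
      refine add_le_add ?_ ?_
      · have h1 := (ih (A ∩ {ω | L t ω ≤ a}) (hAt.inter hC)).1
        have e : ∫⁻ ω in A ∩ {ω | L t ω ≤ a},
            (upc a (a + c) (fun t => L t ω) false (t :: l) : ℝ≥0∞) ∂P
            = ∫⁻ ω in A ∩ {ω | L t ω ≤ a},
            (upc a (a + c) (fun t => L t ω) true l : ℝ≥0∞) ∂P := by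
          refine setLIntegral_congr_fun (ℱ.le t _ (hAt.inter hC)) ?_
          intro ω hω
          have : L t ω ≤ a := hω.2
          simp [upc, this]
        rw [e]
        refine h1.trans ?_
        calc _ ≤ ∫⁻ ω in A ∩ {ω | L t ω ≤ a}, a ∂P :=
              setLIntegral_mono measurable_const (fun ω hω => hω.2)
          _ = _ := by simp
      · have h1 := (ih (A \ {ω | L t ω ≤ a}) (hAt.diff hC)).2
        refine le_trans (le_of_eq ?_) h1
        congr 1
        refine setLIntegral_congr_fun (ℱ.le t _ (hAt.diff hC)) ?_
        intro ω hω
        have : ¬ L t ω ≤ a := hω.2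
        simp [upc, this]

/-- Uniform expected bound over finite sets of times. -/
lemma upc_bound_finset (hL : ∀ t, 0 < t → Measurable[ℱ t] (L t))
    (hsup : ∀ s t, 0 < s → s < t → ∀ A, MeasurableSet[ℱ s] A →
      ∫⁻ ω in A, L t ω ∂P ≤ ∫⁻ ω in A, L s ω ∂P)
    (hone : ∀ t, 0 < t → ∫⁻ ω, L t ω ∂P ≤ 1)
    (a c : ℝ≥0∞) (S : Finset ℝ≥0) (hS : ∀ t ∈ S, 0 < t) :
    c * ∫⁻ ω, (upc a (a + c) (fun t => L t ω) true S.sort : ℝ≥0∞) ∂P ≤ 1 := by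
  obtain ⟨s, hs, hsS⟩ : ∃ s : ℝ≥0, 0 < s ∧ ∀ t ∈ S, s < t := by
    rcases S.eq_empty_or_nonempty with rfl | hne
    · exact ⟨1, one_pos, by simp⟩
    · obtain ⟨s, hs, hs'⟩ := exists_between (hS _ (S.min'_mem hne))
      exact ⟨s, hs, fun t ht => hs'.trans_le (S.min'_le t ht)⟩
  have := (upc_bound hL hsup a c S.sort S.sortedLT_sort.pairwise s hs (by simpa using hsS)
    univ MeasurableSet.univ).1
  simp only [Measure.restrict_univ] at this
  exact this.trans (hone s hs)

/-- Almost surely the number of upcrossings along a countable set is finite. -/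
lemma upc_ae_finite (hL : ∀ t, 0 < t → Measurable[ℱ t] (L t))
    (hsup : ∀ s t, 0 < s → s < t → ∀ A, MeasurableSet[ℱ s] A →
      ∫⁻ ω in A, L t ω ∂P ≤ ∫⁻ ω in A, L s ω ∂P)
    (hone : ∀ t, 0 < t → ∫⁻ ω, L t ω ∂P ≤ 1)
    (d : ℕ → ℝ≥0) (hd : ∀ n, 0 < d n)
    (a b : ℝ≥0∞) (hab : a < b) :
    (b - a) * ∫⁻ ω, (⨆ n, (upc a b (fun t => L t ω) true
      ((Finset.range n).image d).sort : ℝ≥0∞)) ∂P ≤ 1 := by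
  have hb : b = a + (b - a) := (add_tsub_cancel_of_le hab.le).symm
  have hpos : ∀ n, ∀ t ∈ (Finset.range n).image d, 0 < t := by
    intro n t ht
    obtain ⟨k, _, rfl⟩ := Finset.mem_image.1 ht
    exact hd k
  rw [lintegral_iSup, ENNReal.mul_iSup]
  · refine iSup_le fun n => ?_
    have := upc_bound_finset hL hsup hone a (b - a) _ (hpos n)
    rwa [← hb] at this
  · intro n
    exact upc_meas hL a b _ (by simpa using fun k _ => hd k) _
  · intro n n' hn ω
    simp only [Nat.cast_le]
    refine upc_sublist hab _ ?_ _
    refine List.sublist_of_subperm_of_pairwise ?_ (Finset.sortedLT_sort _).pairwise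
      (Finset.sortedLT_sort _).pairwise
    refine List.subperm_of_subset (Finset.sort_nodup _ _) ?_
    intro t
    simp only [Finset.mem_sort]
    exact fun h => Finset.image_subset_image (Finset.range_mono hn) h

end prob
end Rokhlin

namespace Rokhlin

lemma no_osc_right {D : Set ℝ≥0} {x : ℝ≥0 → ℝ≥0∞} {a b : ℝ≥0∞} (hab : a < b)
    (hK : ∃ K : ℕ, ∀ l : List ℝ≥0, l.Pairwise (· < ·) → (∀ s ∈ l, s ∈ D) → upc a b x true l ≤ K)
    (t : ℝ≥0) (h1 : ∃ᶠ s in 𝓝[>] t ⊓ 𝓟 D, x s < a) (h2 : ∃ᶠ s in 𝓝[>] t ⊓ 𝓟 D, b < x s) :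
    False := by
  obtain ⟨K, hK⟩ := hK
  have key : ∀ p : ℝ≥0 → Prop, (∃ᶠ s in 𝓝[>] t ⊓ 𝓟 D, p s) → ∀ u, t < u →
      ∃ s ∈ D, t < s ∧ s < u ∧ p s := by
    intro p hp u hu
    have : ∀ᶠ s in 𝓝[>] t ⊓ 𝓟 D, s ∈ Ioo t u ∧ s ∈ D :=
      Filter.Eventually.and (mem_inf_of_left (Ioo_mem_nhdsGT hu)) (mem_inf_of_right (mem_principal_self D))
    obtain ⟨s, hs, hs1, hs2⟩ := (hp.and_eventually this).exists
    exact ⟨s, hs2, hs1.1, hs1.2, hs⟩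
  have main : ∀ k : ℕ, ∀ u, t < u → ∃ l : List ℝ≥0, l.Pairwise (· < ·) ∧
      (∀ s ∈ l, s ∈ D ∧ t < s ∧ s < u) ∧ k ≤ upc a b x false l := by
    intro k
    induction k with
    | zero => intro u _; exact ⟨[], by simp⟩
    | succ k ih =>
      intro u hu
      obtain ⟨v, hvD, htv, hvu, hv⟩ := key _ h2 u hu
      obtain ⟨w, hwD, htw, hwv, hw⟩ := key _ h1 v htv
      obtain ⟨l, hl, hl2, hl3⟩ := ih w htw
      refine ⟨l ++ [w, v], ?_, ?_, ?_⟩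
      · rw [List.pairwise_append]
        refine ⟨hl, by simp [hwv], ?_⟩
        intro s hs y hy
        have := (hl2 s hs).2.2
        simp at hy
        rcases hy with rfl | rfl
        · exact this
        · exact this.trans hwv
      · intro s hs
        simp at hs
        rcases hs with hs | rfl | rfl
        · exact ⟨(hl2 s hs).1, (hl2 s hs).2.1, (hl2 s hs).2.2.trans (hwv.trans hvu)⟩
        · exact ⟨hwD, htw, hwv.trans hvu⟩
        · exact ⟨hvD, htv, hvu⟩
      · have := upc_append hab x hw.le hv.le l false
        omega
  obtain ⟨l, hl, hl2, hl3⟩ := main (K + 1) (t + 1) (by simp)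
  have := hK l hl (fun s hs => (hl2 s hs).1)
  have := (upc_compare hab x l).1
  omega

lemma no_osc_left {D I : Set ℝ≥0} {x : ℝ≥0 → ℝ≥0∞} {a b : ℝ≥0∞} (hab : a < b)
    (hK : ∃ K : ℕ, ∀ l : List ℝ≥0, l.Pairwise (· < ·) → (∀ s ∈ l, s ∈ D) → upc a b x true l ≤ K)
    (F : Filter ℝ≥0) (hI : I.Nonempty) (hF : ∀ u ∈ I, ∀ᶠ s in F, u < s ∧ s ∈ I)
    (h1 : ∃ᶠ s in F ⊓ 𝓟 D, x s < a) (h2 : ∃ᶠ s in F ⊓ 𝓟 D, b < x s) :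
    False := by
  obtain ⟨K, hK⟩ := hK
  have key : ∀ p : ℝ≥0 → Prop, (∃ᶠ s in F ⊓ 𝓟 D, p s) → ∀ u ∈ I,
      ∃ s ∈ D, s ∈ I ∧ u < s ∧ p s := by
    intro p hp u hu
    have : ∀ᶠ s in F ⊓ 𝓟 D, (u < s ∧ s ∈ I) ∧ s ∈ D :=
      ((hF u hu).filter_mono inf_le_left).and (mem_inf_of_right (mem_principal_self D))
    obtain ⟨s, hs, hs1, hs2⟩ := (hp.and_eventually this).exists
    exact ⟨s, hs2, hs1.2, hs1.1, hs⟩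
  have main : ∀ k : ℕ, ∀ u ∈ I, ∃ l : List ℝ≥0, l.Pairwise (· < ·) ∧
      (∀ s ∈ l, s ∈ D ∧ u < s) ∧ k ≤ upc a b x false l := by
    intro k
    induction k with
    | zero => intro u _; exact ⟨[], by simp⟩
    | succ k ih =>
      intro u hu
      obtain ⟨w, hwD, hwI, huw, hw⟩ := key _ h1 u hu
      obtain ⟨v, hvD, hvI, hwv, hv⟩ := key _ h2 w hwI
      obtain ⟨l, hl, hl2, hl3⟩ := ih v hvI
      refine ⟨w :: v :: l, ?_, ?_, ?_⟩
      · simp only [List.pairwise_cons, List.mem_cons]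
        refine ⟨?_, fun s hs => (hl2 s hs).2, hl⟩
        rintro s (rfl | hs)
        · exact hwv
        · exact hwv.trans (hl2 s hs).2
      · simp only [List.mem_cons]
        rintro s (rfl | rfl | hs)
        · exact ⟨hwD, huw⟩
        · exact ⟨hvD, huw.trans hwv⟩
        · exact ⟨(hl2 s hs).1, huw.trans (hwv.trans (hl2 s hs).2)⟩
      · have := upc_cons (a := a) (b := b) x hw.le hv.le l
        omega
  obtain ⟨u, hu⟩ := hI
  obtain ⟨l, hl, hl2, hl3⟩ := main (K + 1) u hu
  have := hK l hl (fun s hs => (hl2 s hs).1)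
  have := (upc_compare hab x l).1
  omega

/-- A path with finitely many upcrossings along `D`, bounded along `D`. -/
structure GoodPath (D : Set ℝ≥0) (Q : Set ℝ≥0∞) (x : ℝ≥0 → ℝ≥0∞) : Prop where
  up : ∀ a ∈ Q, ∀ b ∈ Q, a < b → ∃ K : ℕ, ∀ l : List ℝ≥0, l.Pairwise (· < ·) →
    (∀ s ∈ l, s ∈ D) → upc a b x true l ≤ K
  bdd : ∃ M : ℝ≥0∞, M ≠ ∞ ∧ ∀ s ∈ D, x s ≤ M

lemma tendsto_of_open {D : Set ℝ≥0} (hD : ∀ u v : ℝ≥0, u < v → ∃ s ∈ D, u < s ∧ s < v)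
    {x r : ℝ≥0 → ℝ≥0∞} (hr : ∀ t, Tendsto x (𝓝[>] t ⊓ 𝓟 D) (𝓝 (r t)))
    (G : Filter ℝ≥0) (hG : ∀ U ∈ G, ∃ V ∈ G, IsOpen V ∧ V ⊆ U) {c : ℝ≥0∞}
    (hc : Tendsto x (G ⊓ 𝓟 D) (𝓝 c)) : Tendsto r G (𝓝 c) := by
  have hne : ∀ t : ℝ≥0, (𝓝[>] t ⊓ 𝓟 D).NeBot := by
    intro t
    rw [((nhdsGT_basis t).inf_principal D).neBot_iff]
    intro u hu
    obtain ⟨s, hs, h1, h2⟩ := hD t u hu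
    exact ⟨s, ⟨h1, h2⟩, hs⟩
  rw [(closed_nhds_basis c).tendsto_right_iff]
  rintro V ⟨hV, hVc⟩
  have h1 := hc hV
  rw [mem_map, mem_inf_principal] at h1
  obtain ⟨U, hUG, hUo, hU⟩ := hG _ h1
  filter_upwards [hUG] with t ht
  refine hVc.mem_of_tendsto (hr t) ?_
  have : ∀ᶠ s in 𝓝[>] t ⊓ 𝓟 D, s ∈ U ∧ s ∈ D :=
    Filter.Eventually.and (mem_inf_of_left (mem_nhdsWithin_of_mem_nhds (hUo.mem_nhds ht)))
      (mem_inf_of_right (mem_principal_self D))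
  filter_upwards [this] with s hs
  exact hU hs.1 hs.2

lemma GoodPath.regular {D : Set ℝ≥0} {Q : Set ℝ≥0∞} {x : ℝ≥0 → ℝ≥0∞}
    (h : GoodPath D Q x) (hQ : Dense Q)
    (hD : ∀ u v : ℝ≥0, u < v → ∃ s ∈ D, u < s ∧ s < v) :
    let r : ℝ≥0 → ℝ≥0∞ := fun t => limsup x (𝓝[>] t ⊓ 𝓟 D)
    (∀ t, Tendsto x (𝓝[>] t ⊓ 𝓟 D) (𝓝 (r t))) ∧ (∀ t, r t ≠ ∞) ∧
    (∀ t, Tendsto (fun s => (r s).toReal) (𝓝[≥] t) (𝓝 (r t).toReal)) ∧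
    (∀ t, 0 < t → ∃ c : ℝ, Tendsto (fun s => (r s).toReal) (𝓝[<] t) (𝓝 c)) ∧
    (∃ c : ℝ≥0∞, c ≠ ∞ ∧ Tendsto x (atTop ⊓ 𝓟 D) (𝓝 c) ∧
      Tendsto (fun s => (r s).toReal) atTop (𝓝 c.toReal)) := by
  intro r
  obtain ⟨M, hM, hxM⟩ := h.bdd
  have hne : ∀ t : ℝ≥0, (𝓝[>] t ⊓ 𝓟 D).NeBot := by
    intro t
    rw [((nhdsGT_basis t).inf_principal D).neBot_iff]
    intro u hu
    obtain ⟨s, hs, h1, h2⟩ := hD t u hu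
    exact ⟨s, ⟨h1, h2⟩, hs⟩
  have hr : ∀ t, Tendsto x (𝓝[>] t ⊓ 𝓟 D) (𝓝 (r t)) := by
    intro t
    obtain ⟨c, hc⟩ := tendsto_of_no_upcrossings (f := 𝓝[>] t ⊓ 𝓟 D) (u := x) hQ
      (fun a ha b hb hab hh => no_osc_right hab (h.up a ha b hb hab) t hh.1 hh.2)
    have : r t = c := hc.limsup_eq
    rwa [this]
  have hfin : ∀ (G : Filter ℝ≥0) (c : ℝ≥0∞), (G ⊓ 𝓟 D).NeBot → Tendsto x (G ⊓ 𝓟 D) (𝓝 c) →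
      c ≠ ∞ := by
    intro G c _ hc
    refine ne_top_of_le_ne_top hM (le_of_tendsto hc ?_)
    exact mem_inf_of_right hxM
  have hrfin : ∀ t, r t ≠ ∞ := fun t => hfin _ _ (hne t) (hr t)
  refine ⟨hr, hrfin, ?_, ?_, ?_⟩
  · intro t
    have h1 : Tendsto r (𝓝[>] t) (𝓝 (r t)) := by
      refine tendsto_of_open hD hr (𝓝[>] t) ?_ (hr t)
      intro U hU
      obtain ⟨u, hu, hu2⟩ := (nhdsGT_basis t).mem_iff.1 hU
      exact ⟨Ioo t u, Ioo_mem_nhdsGT hu, isOpen_Ioo, hu2⟩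
    have h2 : Tendsto (fun s => (r s).toReal) (𝓝[>] t) (𝓝 (r t).toReal) :=
      (ENNReal.tendsto_toReal (hrfin t)).comp h1
    have h3 : ContinuousWithinAt (fun s => (r s).toReal) (Ioi t) t := h2
    exact continuousWithinAt_Ioi_iff_Ici.1 h3
  · intro t ht
    have hopen : ∀ U ∈ 𝓝[<] t, ∃ V ∈ 𝓝[<] t, IsOpen V ∧ V ⊆ U := by
      intro U hU
      obtain ⟨u, hu, hu2⟩ := (nhdsLT_basis_of_exists_lt ⟨0, ht⟩).mem_iff.1 hU
      exact ⟨Ioo u t, Ioo_mem_nhdsLT hu, isOpen_Ioo, hu2⟩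
    have hnb : (𝓝[<] t ⊓ 𝓟 D).NeBot := by
      rw [((nhdsLT_basis_of_exists_lt ⟨0, ht⟩).inf_principal D).neBot_iff]
      intro u hu
      obtain ⟨s, hs, h1, h2⟩ := hD u t hu
      exact ⟨s, ⟨h1, h2⟩, hs⟩
    obtain ⟨c, hc⟩ := tendsto_of_no_upcrossings (f := 𝓝[<] t ⊓ 𝓟 D) (u := x) hQ
      (fun a ha b hb hab hh => no_osc_left (I := Iio t) hab (h.up a ha b hb hab) _ ⟨0, ht⟩
        (fun u hu => Ioo_mem_nhdsLT hu) hh.1 hh.2)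
    exact ⟨c.toReal, (ENNReal.tendsto_toReal (hfin _ _ hnb hc)).comp
      (tendsto_of_open hD hr _ hopen hc)⟩
  · have hopen : ∀ U ∈ (atTop : Filter ℝ≥0), ∃ V ∈ (atTop : Filter ℝ≥0), IsOpen V ∧ V ⊆ U := by
      intro U hU
      obtain ⟨u, hu2⟩ := mem_atTop_sets.1 hU
      exact ⟨Ioi u, Ioi_mem_atTop u, isOpen_Ioi, fun v hv => hu2 v (le_of_lt hv)⟩
    have hnb : ((atTop : Filter ℝ≥0) ⊓ 𝓟 D).NeBot := by
      rw [(atTop_basis.inf_principal D).neBot_iff]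
      intro u _
      obtain ⟨s, hs, h1, h2⟩ := hD u (u + 1) (by simp)
      exact ⟨s, h1.le, hs⟩
    obtain ⟨c, hc⟩ := tendsto_of_no_upcrossings (f := (atTop : Filter ℝ≥0) ⊓ 𝓟 D) (u := x) hQ
      (fun a ha b hb hab hh => no_osc_left (I := univ) hab (h.up a ha b hb hab) _ ⟨0, trivial⟩
        (fun u _ => (eventually_gt_atTop u).mono fun s hs => ⟨hs, trivial⟩) hh.1 hh.2)
    exact ⟨c, hfin _ _ hnb hc, hc, (ENNReal.tendsto_toReal (hfin _ _ hnb hc)).comp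
      (tendsto_of_open hD hr _ hopen hc)⟩

section prob
variable {Ω : Type*} {m : MeasurableSpace Ω} {P : Measure Ω} {ℱ : Filtration ℝ≥0 m}
  {L : ℝ≥0 → Ω → ℝ≥0∞}

lemma ae_goodPath (hL : ∀ t, 0 < t → Measurable[ℱ t] (L t))
    (hsup : ∀ s t, 0 < s → s < t → ∀ A, MeasurableSet[ℱ s] A →
      ∫⁻ ω in A, L t ω ∂P ≤ ∫⁻ ω in A, L s ω ∂P)
    (hone : ∀ t, 0 < t → ∫⁻ ω, L t ω ∂P ≤ 1)
    (d : ℕ → ℝ≥0) (hd : ∀ n, 0 < d n) (Q : Set ℝ≥0∞) (hQ : Q.Countable) :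
    ∀ᵐ ω ∂P, GoodPath (range d) Q (fun t => L t ω) := by
  set U : ℝ≥0∞ → ℝ≥0∞ → Ω → ℝ≥0∞ := fun a b ω => ⨆ n, (upc a b (fun t => L t ω) true
      ((Finset.range n).image d).sort : ℝ≥0∞) with hU
  have hUm : ∀ a b, Measurable (U a b) := fun a b =>
    Measurable.iSup fun n => upc_meas hL a b _ (by simpa using fun k _ => hd k) _
  have hUb : ∀ a b, a < b → (b - a) * ∫⁻ ω, U a b ω ∂P ≤ 1 := fun a b hab =>
    upc_ae_finite hL hsup hone d hd a b hab
  have hle : ∀ a b, a < b → ∀ ω, ∀ l : List ℝ≥0, l.Pairwise (· < ·) →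
      (∀ s ∈ l, s ∈ range d) → (upc a b (fun t => L t ω) true l : ℝ≥0∞) ≤ U a b ω := by
    intro a b hab ω l hl hld
    have : ∃ n, ∀ s ∈ l, s ∈ (Finset.range n).image d := by
      clear hl
      induction l with
      | nil => exact ⟨0, by simp⟩
      | cons s l ih =>
        obtain ⟨n, hn⟩ := ih (fun s hs => hld s (by simp [hs]))
        obtain ⟨k, hk⟩ := hld s (by simp)
        refine ⟨max n (k + 1), ?_⟩
        intro y hy
        rcases List.mem_cons.1 hy with rfl | hy
        · exact Finset.mem_image.2 ⟨k, by simp, hk⟩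
        · exact Finset.image_subset_image (Finset.range_mono (le_max_left _ _)) (hn y hy)
    obtain ⟨n, hn⟩ := this
    refine le_trans ?_ (le_iSup _ n)
    simp only [Nat.cast_le]
    refine upc_sublist hab _ ?_ _
    refine List.sublist_of_subperm_of_pairwise ?_ hl
      (Finset.sortedLT_sort _).pairwise
    refine List.subperm_of_subset (hl.imp ne_of_lt) ?_
    intro t ht
    simp only [Finset.mem_sort]
    exact hn t ht
  have h1 : ∀ᵐ ω ∂P, ∀ a ∈ Q, ∀ b ∈ Q, a < b → U a b ω < ∞ := by
    rw [ae_ball_iff hQ]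
    intro a _
    rw [ae_ball_iff hQ]
    intro b _
    by_cases hab : a < b
    · have : ∫⁻ ω, U a b ω ∂P ≠ ∞ := by
        intro htop
        have := hUb a b hab
        rw [htop, ENNReal.mul_top (tsub_pos_of_lt hab).ne'] at this
        simp at this
      filter_upwards [ae_lt_top (hUm a b) this] with ω hω _ using hω
    · exact Eventually.of_forall fun ω h => absurd h hab
  have h2 : ∀ᵐ ω ∂P, ∃ N : ℕ, 0 < N ∧ U 0 N ω < 1 := by
    have hN : ∀ N : ℕ, 0 < N → P {ω | 1 ≤ U 0 N ω} ≤ (N : ℝ≥0∞)⁻¹ := by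
      intro N hN
      have h3 := hUb 0 N (by exact_mod_cast hN)
      rw [tsub_zero] at h3
      have h4 := mul_meas_ge_le_lintegral (μ := P) (hUm 0 N) 1
      rw [one_mul] at h4
      refine h4.trans ?_
      rw [ENNReal.le_inv_iff_mul_le, mul_comm]
      exact h3
    rw [ae_iff]
    refine le_antisymm (le_of_forall_pos_le_add ?_) zero_le
    intro ε hε
    obtain ⟨N, hN'⟩ := ENNReal.exists_inv_nat_lt hε.ne'
    have h5 : P {ω | ¬∃ N : ℕ, 0 < N ∧ U 0 N ω < 1} ≤ P {ω | 1 ≤ U 0 (N + 1 : ℕ) ω} := by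
      refine measure_mono fun ω hω => ?_
      simp only [mem_ofPred_eq, not_exists, not_and, not_lt] at hω ⊢
      exact hω _ (Nat.succ_pos N)
    rw [zero_add]
    refine h5.trans ((hN _ (Nat.succ_pos N)).trans (le_trans ?_ hN'.le))
    simp only [ENNReal.inv_le_inv]
    exact_mod_cast Nat.le_succ N
  filter_upwards [h1, h2] with ω h1 h2
  constructor
  · intro a ha b hb hab
    obtain ⟨K, hK⟩ := ENNReal.exists_nat_gt (h1 a ha b hb hab).ne
    refine ⟨K, fun l hl hld => ?_⟩
    exact_mod_cast (hle a b hab ω l hl hld).trans hK.le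
  · obtain ⟨N, hN, hUN⟩ := h2
    refine ⟨N, by simp, fun s hs => ?_⟩
    by_contra hcon
    push Not at hcon
    have := hle 0 N (by exact_mod_cast hN) ω [s] (by simp) (by simpa using hs)
    simp [upc, hcon.le] at this
    exact absurd hUN (not_lt.2 this)

lemma measurable_limsup (hright : ∀ t : ℝ≥0, ℱ t = ⨅ (s : ℝ≥0) (_ : t < s), ℱ s)
    (hL : ∀ t, 0 < t → Measurable[ℱ t] (L t)) (D : Set ℝ≥0) (hD : D.Countable) (t : ℝ≥0) :
    Measurable[ℱ t] (fun ω => limsup (fun s => L s ω) (𝓝[>] t ⊓ 𝓟 D)) := by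
  have key : ∀ u, t < u → Measurable[ℱ u] (fun ω => limsup (fun s => L s ω) (𝓝[>] t ⊓ 𝓟 D)) := by
    intro u hu
    classical
    have e : (fun ω => limsup (fun s => L s ω) (𝓝[>] t ⊓ 𝓟 D)) =
        (fun ω => limsup (fun s => (if t < s ∧ s < u then L s else fun _ => 0) ω)
          (𝓝[>] t ⊓ 𝓟 D)) := by
      funext ω
      refine limsup_congr ?_
      refine Filter.Eventually.filter_mono inf_le_left ?_
      filter_upwards [Ioo_mem_nhdsGT hu] with s hs
      have : t < s ∧ s < u := hs
      simp [this]
    rw [e]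
    obtain ⟨s, hs⟩ := (𝓝[>] t).exists_antitone_basis
    have hb := hs.toHasBasis.inf_principal D
    refine Measurable.limsup' (mδ := ℱ u)
      (f := fun s ω => (if t < s ∧ s < u then L s else fun _ => 0) ω) ?_
      (⟨hb, to_countable _⟩ : (𝓝[>] t ⊓ 𝓟 D).HasCountableBasis _ _)
      (fun i => hD.mono inter_subset_right)
    intro i
    split_ifs with hi
    · exact (hL i (lt_of_le_of_lt zero_le hi.1)).mono (ℱ.mono hi.2.le) le_rfl
    · exact measurable_const
  intro B hB
  rw [hright t]
  rw [MeasurableSpace.measurableSet_iInf]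
  intro u
  rw [MeasurableSpace.measurableSet_iInf]
  intro hu
  exact key u hu hB
end prob
end Rokhlin

namespace Rokhlin

lemma exp_bernoulli {e y : ℝ} (he0 : 0 ≤ e) (he1 : e ≤ 1) :
    Real.exp (e * y) ≤ 1 + e * (Real.exp y - 1) := by
  have := convexOn_exp.2 (mem_univ (0:ℝ)) (mem_univ y) (sub_nonneg.2 he1) he0 (by ring)
  simp only [smul_eq_mul, mul_zero, zero_add, Real.exp_zero] at this
  linarith

section yan
variable {Ω : Type*} {m : MeasurableSpace Ω} {P : Measure Ω} [IsProbabilityMeasure P]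

lemma integrable_exp_neg {X : Ω → ℝ} (hX : AEMeasurable X P) (h0 : ∀ᵐ ω ∂P, 0 ≤ X ω) :
    Integrable (fun ω => Real.exp (-X ω)) P := by
  refine Integrable.of_bound (C := 1) (Real.measurable_exp.comp_aemeasurable
    hX.neg).aestronglyMeasurable ?_
  filter_upwards [h0] with ω hω
  rw [Real.norm_of_nonneg (Real.exp_pos _).le]
  simpa using hω

lemma tendsto_integral_exp_neg {X : ℕ → Ω → ℝ} {X' : Ω → ℝ} (hX : ∀ n, AEMeasurable (X n) P)
    (h0 : ∀ n, ∀ᵐ ω ∂P, 0 ≤ X n ω)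
    (h : ∀ᵐ ω ∂P, Tendsto (fun n => X n ω) atTop (𝓝 (X' ω))) :
    Tendsto (fun n => ∫ ω, Real.exp (-X n ω) ∂P) atTop (𝓝 (∫ ω, Real.exp (-X' ω) ∂P)) := by
  refine tendsto_integral_of_dominated_convergence (fun _ => 1)
    (fun n => (integrable_exp_neg (hX n) (h0 n)).aestronglyMeasurable) (integrable_const _) ?_ ?_
  · intro n
    filter_upwards [h0 n] with ω hω
    rw [Real.norm_of_nonneg (Real.exp_pos _).le]
    simpa using hω
  · filter_upwards [h] with ω hω
    exact (Real.continuous_exp.tendsto _).comp hω.neg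

lemma exists_density (K : Set (Ω → ℝ)) (hm : ∀ X ∈ K, Measurable X)
    (hnn : ∀ X ∈ K, ∀ ω, 0 ≤ X ω) (hne : K.Nonempty)
    (hconv : ∀ X ∈ K, ∀ X' ∈ K, ∀ θ : ℝ, 0 ≤ θ → θ ≤ 1 → ∃ W : ℕ → Ω → ℝ, (∀ n, W n ∈ K) ∧
      ∀ ω, Tendsto (fun n => W n ω) atTop (𝓝 (θ * X ω + (1 - θ) * X' ω)))
    (hbdd : ∀ ε : ℝ≥0∞, 0 < ε → ∃ M : ℝ, ∀ X ∈ K, P {ω | M ≤ X ω} ≤ ε) :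
    ∃ g : Ω → ℝ, Measurable g ∧ (∀ ω, 0 < g ω) ∧ (∀ ω, g ω ≤ 1) ∧
      ∀ X ∈ K, ∫⁻ ω, ENNReal.ofReal (g ω * X ω) ∂P ≤ 1 := by
  set J : (Ω → ℝ) → ℝ := fun X => ∫ ω, Real.exp (-X ω) ∂P with hJ
  set I : ℝ := sInf (J '' K) with hI
  have hbelow : BddBelow (J '' K) := by
    refine ⟨0, ?_⟩
    rintro _ ⟨X, _, rfl⟩
    exact integral_nonneg fun ω => (Real.exp_pos _).le
  have hIle : ∀ X ∈ K, I ≤ J X := fun X hX => csInf_le hbelow ⟨X, hX, rfl⟩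
  have hIconv : ∀ X ∈ K, ∀ X' ∈ K, ∀ θ : ℝ, 0 ≤ θ → θ ≤ 1 →
      I ≤ ∫ ω, Real.exp (-(θ * X ω + (1 - θ) * X' ω)) ∂P := by
    intro X hX X' hX' θ h0 h1
    obtain ⟨W, hW, hlim⟩ := hconv X hX X' hX' θ h0 h1
    have := tendsto_integral_exp_neg (P := P) (fun n => (hm _ (hW n)).aemeasurable)
      (fun n => Eventually.of_forall (hnn _ (hW n))) (Eventually.of_forall hlim)
    exact ge_of_tendsto' this fun n => hIle _ (hW n)
  have hex : ∀ n : ℕ, ∃ X ∈ K, J X < I + (1/4 : ℝ) ^ n := by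
    intro n
    obtain ⟨_, ⟨X, hX, rfl⟩, h⟩ := exists_lt_of_csInf_lt (hne.image J)
      (show sInf (J '' K) < I + (1/4 : ℝ) ^ n by
        have : (0:ℝ) < (1/4 : ℝ) ^ n := by positivity
        linarith)
    exact ⟨X, hX, h⟩
  choose X hXK hXJ using hex
  have hXm := fun n => hm _ (hXK n)
  have hX0 := fun n => hnn _ (hXK n)
  set a : ℕ → Ω → ℝ := fun n ω => Real.exp (-(X n ω / 2)) with ha
  have ham : ∀ n, Measurable (a n) := fun n => Real.measurable_exp.comp ((hXm n).div_const 2).neg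
  have hsq : ∀ n k, ∫ ω, (a n ω - a k ω) ^ 2 ∂P ≤ J (X n) + J (X k) - 2 * I := by
    intro n k
    have i1 := integrable_exp_neg (P := P) (hXm n).aemeasurable (Eventually.of_forall (hX0 n))
    have i2 := integrable_exp_neg (P := P) (hXm k).aemeasurable (Eventually.of_forall (hX0 k))
    have i3 : Integrable (fun ω => Real.exp (-((1/2) * X n ω + (1 - 1/2) * X k ω))) P := by
      refine integrable_exp_neg (P := P) (((hXm n).const_mul _).add
        ((hXm k).const_mul _)).aemeasurable (Eventually.of_forall fun ω => ?_)
      have := hX0 n ω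
      have := hX0 k ω
      positivity
    have e : ∀ ω, (a n ω - a k ω) ^ 2 = Real.exp (-X n ω) + Real.exp (-X k ω)
        - 2 * Real.exp (-((1/2) * X n ω + (1 - 1/2) * X k ω)) := by
      intro ω
      have e1 : Real.exp (-X n ω) = a n ω * a n ω := by
        rw [ha, ← Real.exp_add]; congr 1; ring
      have e2 : Real.exp (-X k ω) = a k ω * a k ω := by
        rw [ha, ← Real.exp_add]; congr 1; ring
      have e3 : Real.exp (-((1/2) * X n ω + (1 - 1/2) * X k ω)) = a n ω * a k ω := by
        rw [ha, ← Real.exp_add]; congr 1; ring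
      rw [e1, e2, e3]; ring
    have := hIconv _ (hXK n) _ (hXK k) (1/2) (by norm_num) (by norm_num)
    simp_rw [e]
    have i4 : Integrable (fun ω => Real.exp (-X n ω) + Real.exp (-X k ω)) P := i1.add i2
    rw [integral_sub i4 (i3.const_mul 2), integral_add i1 i2, integral_const_mul]
    linarith
  have hab : ∀ n ω, 0 < a n ω ∧ a n ω ≤ 1 := by
    intro n ω
    refine ⟨Real.exp_pos _, ?_⟩
    have := hX0 n ω
    simp [ha]; linarith
  have hdint : ∀ n k, Integrable (fun ω => a n ω - a k ω) P := by
    intro n k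
    refine Integrable.of_bound (C := 1) ((ham n).sub (ham k)).aestronglyMeasurable
      (Eventually.of_forall fun ω => ?_)
    rw [Real.norm_eq_abs, abs_le]
    constructor <;> linarith [hab n ω, hab k ω]
  have hdint2 : ∀ n k, Integrable (fun ω => (a n ω - a k ω) ^ 2) P := by
    intro n k
    refine Integrable.of_bound (C := 1) (((ham n).sub (ham k)).pow_const 2).aestronglyMeasurable
      (Eventually.of_forall fun ω => ?_)
    rw [Real.norm_of_nonneg (sq_nonneg _), sq_le_one_iff_abs_le_one, abs_le]
    constructor <;> linarith [hab n ω, hab k ω]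
  have hlim : ∀ᵐ ω ∂P, ∃ l, Tendsto (fun n => a n ω) atTop (𝓝 l) := by
    refine Lp.ae_tendsto_of_cauchy_eLpNorm (p := 1) (B := fun N => ENNReal.ofReal (2 * (1/2)^N))
      (fun n => (ham n).aestronglyMeasurable) le_rfl ?_ ?_
    · exact (Summable.mul_left 2 (summable_geometric_of_lt_one (by norm_num)
        (by norm_num))).tsum_ofReal_ne_top
    · intro N n k hn hk
      have hdi : Integrable (a n - a k) P := hdint n k
      rw [eLpNorm_one_eq_lintegral_enorm, ← ofReal_integral_norm_eq_lintegral_enorm hdi]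
      have hpos : (0:ℝ) < (1/2)^N := by positivity
      rw [ENNReal.ofReal_lt_ofReal_iff (by positivity)]
      have hn' : ((1/4 : ℝ))^n ≤ (1/4)^N := pow_le_pow_of_le_one (by norm_num) (by norm_num) hn
      have hk' : ((1/4 : ℝ))^k ≤ (1/4)^N := pow_le_pow_of_le_one (by norm_num) (by norm_num) hk
      have h4 : (1/4 : ℝ)^N = (1/2)^N * (1/2)^N := by rw [← mul_pow]; norm_num
      set η : ℝ := (1/2)^N with hη
      have hsqle : ∫ ω, (a n ω - a k ω) ^ 2 ∂P ≤ 2 * (η * η) := by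
        have := hsq n k
        have := hXJ n
        have := hXJ k
        linarith
      have hpt : ∀ ω, ‖(a n - a k) ω‖ ≤ (1/(2*η)) * (a n ω - a k ω)^2 + η/2 := by
        intro ω
        rw [Pi.sub_apply, Real.norm_eq_abs, ← sq_abs (a n ω - a k ω)]
        have h0 := sq_nonneg (|a n ω - a k ω| - η)
        have e : (1/(2*η)) * |a n ω - a k ω|^2 + η/2 - |a n ω - a k ω|
          = (|a n ω - a k ω| - η)^2 / (2*η) := by field_simp; ring
        have : 0 ≤ (|a n ω - a k ω| - η)^2 / (2*η) := by positivity
        linarith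
      calc ∫ ω, ‖(a n - a k) ω‖ ∂P ≤ ∫ ω, ((1/(2*η)) * (a n ω - a k ω)^2 + η/2) ∂P :=
            integral_mono (hdint n k).norm
              (((hdint2 n k).const_mul _).add (integrable_const _)) hpt
        _ = (1/(2*η)) * ∫ ω, (a n ω - a k ω)^2 ∂P + η/2 := by
            rw [integral_add ((hdint2 n k).const_mul _) (integrable_const _), integral_const_mul]
            simp
        _ ≤ (1/(2*η)) * (2 * (η*η)) + η/2 := by gcongr
        _ = η + η/2 := by field_simp
        _ < 2 * η := by linarith
  -- the limit is positive
  have hpos : ∀ᵐ ω ∂P, ¬ Tendsto (fun n => a n ω) atTop (𝓝 0) := by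
    rw [ae_iff]
    simp only [not_not]
    refine le_antisymm (le_of_forall_pos_le_add fun ε hε => ?_) zero_le
    rw [zero_add]
    obtain ⟨M, hM⟩ := hbdd ε hε
    have hsub : {ω | Tendsto (fun n => a n ω) atTop (𝓝 0)} ⊆
        ⋃ N : ℕ, ⋂ n ≥ N, {ω | M ≤ X n ω} := by
      intro ω hω
      have h1 : ∀ᶠ n in atTop, a n ω < Real.exp (-(M/2)) :=
        (hω : Tendsto _ _ _).eventually_lt_const (Real.exp_pos _)
      obtain ⟨N, hN⟩ := eventually_atTop.1 h1
      simp only [mem_iUnion, mem_iInter]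
      refine ⟨N, fun n hn => ?_⟩
      have := Real.exp_lt_exp.1 (hN n hn)
      show M ≤ X n ω
      linarith
    refine (measure_mono hsub).trans ?_
    rw [Monotone.measure_iUnion]
    · refine iSup_le fun N => ?_
      exact (measure_mono (biInter_subset_of_mem (le_refl N))).trans (hM _ (hXK N))
    · intro N N' hNN
      exact biInter_subset_biInter_left fun n (hn : n ≥ N') => le_trans hNN hn
  have hlimX : ∀ᵐ ω ∂P, ∃ l, Tendsto (fun n => X n ω) atTop (𝓝 l) := by
    filter_upwards [hlim, hpos] with ω ⟨l, hl⟩ hne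
    have hl0 : l ≠ 0 := by rintro rfl; exact hne hl
    refine ⟨-2 * Real.log l, ?_⟩
    have := (hl.log hl0).const_mul (-2)
    refine this.congr fun n => ?_
    simp only [ha, Real.log_exp]; ring
  obtain ⟨Xl, hXlm, hXl⟩ := measurable_limit_of_tendsto_metrizable_ae
    (fun n => (hXm n).aemeasurable) hlimX
  have hXl0 : ∀ᵐ ω ∂P, 0 ≤ Xl ω := by
    filter_upwards [hXl] with ω hω
    exact ge_of_tendsto' hω fun n => hX0 n ω
  set Xh : Ω → ℝ := fun ω => max (Xl ω) 0 with hXh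
  have hXhm : Measurable Xh := hXlm.max measurable_const
  have hXh0 : ∀ ω, 0 ≤ Xh ω := fun ω => le_max_right _ _
  have hXhlim : ∀ᵐ ω ∂P, Tendsto (fun n => X n ω) atTop (𝓝 (Xh ω)) := by
    filter_upwards [hXl, hXl0] with ω h1 h2
    simpa [hXh, max_eq_left h2] using h1
  have hJh : J Xh = I := by
    have h1 := tendsto_integral_exp_neg (P := P) (fun n => (hXm n).aemeasurable)
      (fun n => Eventually.of_forall (hX0 n)) hXhlim
    refine tendsto_nhds_unique h1 ?_
    have h2 : Tendsto (fun n : ℕ => I + (1/4 : ℝ) ^ n) atTop (𝓝 (I + 0)) :=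
      tendsto_const_nhds.add (tendsto_pow_atTop_nhds_zero_of_lt_one (by norm_num) (by norm_num))
    rw [add_zero] at h2
    exact tendsto_of_tendsto_of_tendsto_of_le_of_le tendsto_const_nhds h2
      (fun n => hIle _ (hXK n)) (fun n => (hXJ n).le)
  refine ⟨fun ω => Real.exp (-Xh ω), Real.measurable_exp.comp hXhm.neg,
    fun ω => Real.exp_pos _, fun ω => by simpa using hXh0 ω, ?_⟩
  intro V hV
  have hV0 := hnn V hV
  have hVm := hm V hV
  set e : ℕ → ℝ := fun n => 1 / ((n : ℝ) + 1) with he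
  have he0 : ∀ n, 0 < e n := fun n => by simp only [he]; positivity
  have he1 : ∀ n, e n ≤ 1 := fun n => by
    simp only [he]; rw [div_le_one (by positivity)]; linarith [(Nat.cast_nonneg n : (0:ℝ) ≤ n)]
  set h : ℕ → Ω → ℝ := fun n ω =>
    Real.exp (-Xh ω) * (1 - Real.exp (-(e n * (V ω - Xh ω)))) / e n + 1 with hh
  have hhm : ∀ n, Measurable (h n) := by
    intro n
    have : Measurable (fun ω => Real.exp (-(e n * (V ω - Xh ω)))) :=
      Real.measurable_exp.comp ((hVm.sub hXhm).const_mul _).neg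
    exact (((Real.measurable_exp.comp hXhm.neg).mul (measurable_const.sub this)).div_const
      _).add_const _
  have hhnn : ∀ n ω, 0 ≤ h n ω := by
    intro n ω
    have h1 : Real.exp (-(e n * (V ω - Xh ω))) ≤ Real.exp (e n * Xh ω) := by
      apply Real.exp_le_exp.2
      have := mul_nonneg (he0 n).le (hV0 ω)
      linarith
    have h2 := exp_bernoulli (y := Xh ω) (he0 n).le (he1 n)
    have h3 : Real.exp (-Xh ω) * Real.exp (Xh ω) = 1 := by rw [← Real.exp_add]; simp
    have h4 := Real.exp_pos (-Xh ω)
    have h5 : -(e n * (1 - Real.exp (-Xh ω))) ≤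
        Real.exp (-Xh ω) * (1 - Real.exp (-(e n * (V ω - Xh ω)))) := by
      have h6 : -(e n * (Real.exp (Xh ω) - 1)) ≤ 1 - Real.exp (-(e n * (V ω - Xh ω))) := by
        linarith
      have h7 := mul_le_mul_of_nonneg_left h6 h4.le
      have h8 : Real.exp (-Xh ω) * -(e n * (Real.exp (Xh ω) - 1)) =
        -(e n * (Real.exp (-Xh ω) * Real.exp (Xh ω) - Real.exp (-Xh ω))) := by ring
      rw [h8, h3] at h7
      exact h7
    have h9 : -(1 - Real.exp (-Xh ω)) ≤
        Real.exp (-Xh ω) * (1 - Real.exp (-(e n * (V ω - Xh ω)))) / e n := by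
      rw [le_div_iff₀ (he0 n)]; linarith
    simp only [hh]; linarith
  have hhintg : ∀ n, ∫⁻ ω, ENNReal.ofReal (h n ω) ∂P ≤ 1 := by
    intro n
    have i1 := integrable_exp_neg (P := P) hXhm.aemeasurable (Eventually.of_forall hXh0)
    have hcomb : ∀ ω, 0 ≤ e n * V ω + (1 - e n) * Xh ω := fun ω =>
      add_nonneg (mul_nonneg (he0 n).le (hV0 ω)) (mul_nonneg (sub_nonneg.2 (he1 n)) (hXh0 ω))
    have i2 := integrable_exp_neg (P := P) (X := fun ω => e n * V ω + (1 - e n) * Xh ω)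
      ((hVm.const_mul _).add (hXhm.const_mul _)).aemeasurable (Eventually.of_forall hcomb)
    have eq : ∀ ω, h n ω = (Real.exp (-Xh ω) -
        Real.exp (-(e n * V ω + (1 - e n) * Xh ω))) / e n + 1 := by
      intro ω
      simp only [hh]
      rw [mul_sub, mul_one, ← Real.exp_add]
      congr 4; ring_nf
    have hintg : Integrable (h n) P := by
      rw [funext eq]
      exact ((i1.sub i2).div_const _).add (integrable_const _)
    rw [← ofReal_integral_eq_lintegral_ofReal hintg (Eventually.of_forall (hhnn n))]
    have hle : I ≤ ∫ ω, Real.exp (-(e n * V ω + (1 - e n) * Xh ω)) ∂P := by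
      have := tendsto_integral_exp_neg (P := P)
        (X := fun k ω => e n * V ω + (1 - e n) * X k ω)
        (X' := fun ω => e n * V ω + (1 - e n) * Xh ω)
        (fun k => ((hVm.const_mul _).add ((hXm k).const_mul _)).aemeasurable)
        (fun k => Eventually.of_forall fun ω =>
          add_nonneg (mul_nonneg (he0 n).le (hV0 ω)) (mul_nonneg (sub_nonneg.2 (he1 n)) (hX0 k ω)))
        (by
          filter_upwards [hXhlim] with ω hω
          exact tendsto_const_nhds.add (hω.const_mul _))
      exact ge_of_tendsto' this fun k => hIconv V hV _ (hXK k) _ (he0 n).le (he1 n)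
    have : ∫ ω, h n ω ∂P ≤ 1 := by
      have i4 : Integrable (fun ω => (Real.exp (-Xh ω) -
        Real.exp (-(e n * V ω + (1 - e n) * Xh ω))) / e n) P := (i1.sub i2).div_const _
      simp_rw [eq]
      rw [integral_add i4 (integrable_const _), integral_div, integral_sub i1 i2]
      have hJh' : ∫ ω, Real.exp (-Xh ω) ∂P = I := hJh
      rw [hJh']
      have : (I - ∫ ω, Real.exp (-(e n * V ω + (1 - e n) * Xh ω)) ∂P) / e n ≤ 0 :=
        div_nonpos_of_nonpos_of_nonneg (by linarith) (he0 n).le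
      have e1 : ∫ _ω : Ω, (1:ℝ) ∂P = 1 := by simp
      rw [e1]; linarith
    simpa using ENNReal.ofReal_le_ofReal this
  have hhlim : ∀ ω, Tendsto (fun n => h n ω) atTop
      (𝓝 (Real.exp (-Xh ω) * (V ω - Xh ω) + 1)) := by
    intro ω
    refine Tendsto.add ?_ tendsto_const_nhds
    set u := V ω - Xh ω with hu
    have hd : HasDerivAt (fun y : ℝ => 1 - Real.exp (-(y * u))) u 0 := by
      have h1 : HasDerivAt (fun y : ℝ => -(y * u)) (-(1 * u)) 0 :=
        ((hasDerivAt_id' (0:ℝ)).mul_const u).neg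
      have := (h1.exp).const_sub 1
      simpa using this
    have ht : Tendsto e atTop (𝓝[≠] 0) := by
      rw [tendsto_nhdsWithin_iff]
      exact ⟨tendsto_one_div_add_atTop_nhds_zero_nat,
        Eventually.of_forall fun n => (he0 n).ne'⟩
    have := (hasDerivAt_iff_tendsto_slope.1 hd).comp ht
    refine (this.const_mul (Real.exp (-Xh ω))).congr fun n => ?_
    simp only [Function.comp, slope_def_field]
    simp
    ring
  calc ∫⁻ ω, ENNReal.ofReal (Real.exp (-Xh ω) * V ω) ∂P
      ≤ ∫⁻ ω, liminf (fun n => ENNReal.ofReal (h n ω)) atTop ∂P := by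
        refine lintegral_mono fun ω => ?_
        have := (ENNReal.continuous_ofReal.tendsto _).comp (hhlim ω)
        have h2 := this.liminf_eq
        simp only [Function.comp_def] at h2
        rw [h2]
        apply ENNReal.ofReal_le_ofReal
        have h3 : Xh ω * Real.exp (-Xh ω) ≤ 1 := by
          have h4 : Xh ω ≤ Real.exp (Xh ω) := by linarith [Real.add_one_le_exp (Xh ω)]
          rw [Real.exp_neg, ← div_eq_mul_inv, div_le_one (Real.exp_pos _)]
          exact h4
        linarith
    _ ≤ liminf (fun n => ∫⁻ ω, ENNReal.ofReal (h n ω) ∂P) atTop :=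
        lintegral_liminf_le fun n => (hhm n).ennreal_ofReal
    _ ≤ 1 := by
        refine liminf_le_of_le (by isBoundedDefault) fun b hb => ?_
        obtain ⟨n, hn⟩ := hb.exists
        exact hn.trans (hhintg n)

end yan
end Rokhlin

namespace Rokhlin

section esssup
variable {Ω : Type*} {m : MeasurableSpace Ω} {P : Measure Ω} [IsProbabilityMeasure P]

lemma exists_esssup (G : MeasurableSpace Ω) (hG : G ≤ m) (R : Set (Ω → ℝ≥0∞))
    (hRm : ∀ ρ ∈ R, Measurable[m] ρ) (hne : R.Nonempty)
    (hdir : ∀ ρ ∈ R, ∀ ρ' ∈ R, ∀ A, MeasurableSet[G] A → A.indicator ρ + Aᶜ.indicator ρ' ∈ R)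
    (hb : ∀ ρ ∈ R, ∫⁻ ω, ρ ω ∂P ≤ 1) :
    ∃ L : Ω → ℝ≥0∞, Measurable[G] L ∧
      (∀ ρ ∈ R, ∀ f : Ω → ℝ≥0∞, Measurable[G] f →
        ∫⁻ ω, f ω * ρ ω ∂P ≤ ∫⁻ ω, f ω * L ω ∂P) ∧
      (∀ f : Ω → ℝ≥0∞, Measurable[G] f →
        ∫⁻ ω, f ω * L ω ∂P ≤ ⨆ ρ ∈ R, ∫⁻ ω, f ω * ρ ω ∂P) := by
  have hex : ∃ ρ, ρ ∈ R := hne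
  set n : Set Ω → ℝ≥0∞ := fun A => ⨆ ρ ∈ R, ∫⁻ ω in A, ρ ω ∂P with hn
  have hn0 : n ∅ = 0 := by simp [hn]
  have hmono : ∀ A B, A ⊆ B → n A ≤ n B := by
    intro A B h
    exact iSup₂_mono fun ρ _ => lintegral_mono_set h
  have hadd : ∀ A B, MeasurableSet[G] A → MeasurableSet[G] B → Disjoint A B →
      n A + n B ≤ n (A ∪ B) := by
    intro A B hA hB hAB
    refine ENNReal.biSup_add_biSup_le' hex hex ?_
    intro ρ hρ ρ' hρ'
    refine le_trans ?_ (le_iSup₂ (f := fun ρ (_ : ρ ∈ R) => ∫⁻ ω in A ∪ B, ρ ω ∂P) _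
      (hdir ρ hρ ρ' hρ' A hA))
    rw [lintegral_union (hG _ hB) hAB]
    refine add_le_add (le_of_eq ?_) (le_of_eq ?_)
    · refine setLIntegral_congr_fun (hG _ hA) fun ω hω => ?_
      simp [hω]
    · refine setLIntegral_congr_fun (hG _ hB) fun ω hω => ?_
      have : ω ∉ A := fun h => hAB.le_bot ⟨h, hω⟩
      simp [this]
  have hfin : ∀ (f : ℕ → Set Ω), (∀ i, MeasurableSet[G] (f i)) →
      Pairwise (Function.onFun Disjoint f) → ∀ S : Finset ℕ,
      ∑ i ∈ S, n (f i) ≤ n (⋃ i ∈ S, f i) := by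
    intro f h hd S
    induction S using Finset.induction_on with
    | empty => simp
    | insert k S hk ih =>
      rw [Finset.sum_insert hk]
      have hm2 : MeasurableSet[G] (⋃ i ∈ S, f i) :=
        @Finset.measurableSet_biUnion _ _ G f S fun i _ => h i
      refine (add_le_add le_rfl ih).trans ((hadd _ _ (h k) hm2 ?_).trans (hmono _ _ ?_))
      · rw [Set.disjoint_iUnion₂_right]
        intro i hi
        exact hd (fun hki => hk (hki ▸ hi))
      · simp
  have hU : ∀ ⦃f : ℕ → Set Ω⦄, (∀ i, MeasurableSet[G] (f i)) →
      Pairwise (Function.onFun Disjoint f) →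
      n (⋃ i, f i) = ∑' i, n (f i) := by
    intro f h hd
    apply le_antisymm
    · refine iSup₂_le fun ρ hρ => ?_
      rw [lintegral_iUnion (fun i => hG _ (h i)) hd]
      refine ENNReal.tsum_le_tsum fun i => ?_
      exact le_iSup₂ (f := fun ρ (_ : ρ ∈ R) => ∫⁻ ω in f i, ρ ω ∂P) ρ hρ
    · rw [ENNReal.tsum_eq_iSup_sum]
      refine iSup_le fun S => (hfin f h hd S).trans (hmono _ _ ?_)
      exact iUnion₂_subset_iUnion _ _
  set ν : @Measure Ω G := @Measure.ofMeasurable Ω G (fun A _ => n A) hn0 hU with hν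
  have hνa : ∀ A (hA : MeasurableSet[G] A), ν A = ⨆ ρ ∈ R, ∫⁻ ω in A, ρ ω ∂P :=
    fun A hA => @Measure.ofMeasurable_apply Ω G (fun A _ => n A) hn0 hU A hA
  have hνfin : @IsFiniteMeasure Ω G ν := by
    refine ⟨?_⟩
    rw [hνa _ (@MeasurableSet.univ _ G)]
    refine lt_of_le_of_lt (iSup₂_le fun ρ hρ => ?_) ENNReal.one_lt_top
    simpa using hb ρ hρ
  have hac : ν ≪ P.trim hG := by
    refine Measure.AbsolutelyContinuous.mk fun A hA h0 => ?_
    rw [trim_measurableSet_eq hG hA] at h0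
    rw [hνa A hA]
    simp [Measure.restrict_eq_zero.2 h0]
  have hintg : ∀ f : Ω → ℝ≥0∞, Measurable[G] f →
      ∫⁻ ω, f ω * (ν.rnDeriv (P.trim hG)) ω ∂P = ∫⁻ ω, f ω ∂ν := by
    intro f hf
    have hrm : Measurable[G] (ν.rnDeriv (P.trim hG)) := Measure.measurable_rnDeriv _ _
    have hfr : Measurable[G] (fun ω => f ω * (ν.rnDeriv (P.trim hG)) ω) := hf.mul hrm
    rw [← lintegral_trim hG hfr]
    conv_rhs => rw [← Measure.withDensity_rnDeriv_eq ν (P.trim hG) hac]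
    rw [lintegral_withDensity_eq_lintegral_mul _ hrm hf]
    simp [mul_comm]
  refine ⟨ν.rnDeriv (P.trim hG), Measure.measurable_rnDeriv _ _, ?_, ?_⟩
  · intro ρ hρ f hf
    rw [hintg f hf]
    have hle : (P.withDensity ρ).trim hG ≤ ν := by
      refine Measure.le_intro fun A hA _ => ?_
      rw [trim_measurableSet_eq hG hA, withDensity_apply _ (hG _ hA), hνa A hA]
      exact le_iSup₂ (f := fun ρ (_ : ρ ∈ R) => ∫⁻ ω in A, ρ ω ∂P) ρ hρ
    refine le_trans (le_of_eq ?_) (lintegral_mono' hle le_rfl)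
    rw [lintegral_trim hG hf,
      lintegral_withDensity_eq_lintegral_mul _ (hRm ρ hρ) (hf.mono hG le_rfl)]
    simp [mul_comm]
  · intro f hf
    rw [hintg f hf]
    refine @Measurable.ennreal_induction Ω G
      (fun f => ∫⁻ ω, f ω ∂ν ≤ ⨆ ρ ∈ R, ∫⁻ ω, f ω * ρ ω ∂P) ?_ ?_ ?_ f hf
    · intro c A hA
      rw [lintegral_indicator hA, setLIntegral_const, hνa A hA, ENNReal.mul_iSup]
      refine iSup_mono fun ρ => ?_
      rw [ENNReal.mul_iSup]
      refine iSup_mono fun hρ => ?_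
      rw [← lintegral_const_mul c (hRm ρ hρ), ← lintegral_indicator (hG _ hA)]
      refine lintegral_mono fun ω => ?_
      by_cases h : ω ∈ A <;> simp [h]
    · intro f f' hff' hf hf' h h'
      simp only [Pi.add_apply]
      rw [lintegral_add_left hf]
      refine (add_le_add h h').trans (ENNReal.biSup_add_biSup_le' hex hex ?_)
      intro ρ hρ ρ' hρ'
      have hA : MeasurableSet[G] (Function.support f) := measurableSet_support hf
      refine le_trans ?_ (le_iSup₂ (f := fun ρ (_ : ρ ∈ R) => ∫⁻ ω, (f ω + f' ω) * ρ ω ∂P) _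
        (hdir ρ hρ ρ' hρ' _ hA))
      have hfr : Measurable[m] (fun ω => f ω * ρ ω) := (hf.mono hG le_rfl).mul (hRm ρ hρ)
      rw [← lintegral_add_left hfr]
      refine lintegral_mono fun ω => ?_
      by_cases h : f ω = 0
      · simp [h]
      · have : f' ω = 0 := by
          by_contra h2
          exact hff'.le_bot ⟨h, h2⟩
        simp [h, this]
    · intro f hf hfm h
      rw [lintegral_iSup hf hfm]
      refine iSup_le fun k => (h k).trans ?_
      refine iSup₂_mono fun ρ _ => lintegral_mono fun ω => ?_
      exact mul_le_mul_left (le_iSup (fun k => f k ω) k) _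

end esssup

section reg
variable {Ω : Type*} {m : MeasurableSpace Ω} {P : Measure Ω} [IsProbabilityMeasure P]
  {ℱ : Filtration ℝ≥0 m}

lemma trunc_le {G : MeasurableSpace Ω} (hG : G ≤ m) {V W : Ω → ℝ≥0∞} (hV : Measurable[G] V)
    (h : ∀ A, MeasurableSet[G] A → ∫⁻ ω in A, W ω ∂P ≤ ∫⁻ ω in A, V ω ∂P) (c : ℝ≥0∞)
    (A : Set Ω) (hA : MeasurableSet[G] A) :
    ∫⁻ ω in A, min (W ω) c ∂P ≤ ∫⁻ ω in A, min (V ω) c ∂P := by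
  have hB : MeasurableSet[G] {ω | V ω ≤ c} :=
    @measurableSet_le _ _ _ _ _ G _ _ _ _ _ hV measurable_const
  rw [← lintegral_inter_add_sdiff _ A (hG _ hB), ← lintegral_inter_add_sdiff (fun ω => min (V ω) c)
    A (hG _ hB)]
  refine add_le_add ?_ ?_
  · calc _ ≤ ∫⁻ ω in A ∩ {ω | V ω ≤ c}, W ω ∂P := lintegral_mono fun ω => min_le_left _ _
      _ ≤ ∫⁻ ω in A ∩ {ω | V ω ≤ c}, V ω ∂P := h _ (hA.inter hB)
      _ = _ := by
        refine setLIntegral_congr_fun (hG _ (hA.inter hB)) fun ω hω => ?_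
        exact (min_eq_left hω.2).symm
  · calc _ ≤ ∫⁻ ω in A \ {ω | V ω ≤ c}, c ∂P := lintegral_mono fun ω => min_le_right _ _
      _ = _ := by
        refine setLIntegral_congr_fun (hG _ (hA.diff hB)) fun ω hω => ?_
        exact (min_eq_right (le_of_not_ge hω.2)).symm

lemma reg_super {V V' : ℝ≥0 → Ω → ℝ≥0∞} {D : Set ℝ≥0}
    (hD : ∀ u v : ℝ≥0, u < v → ∃ s ∈ D, u < s ∧ s < v)
    (hV : ∀ t, 0 < t → Measurable[ℱ t] (V t))
    (hsup : ∀ s t, 0 < s → s < t → ∀ A, MeasurableSet[ℱ s] A →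
      ∫⁻ ω in A, V t ω ∂P ≤ ∫⁻ ω in A, V s ω ∂P)
    (hone : ∀ t, 0 < t → ∫⁻ ω, V t ω ∂P ≤ 1)
    (hV' : ∀ t, Measurable (V' t))
    (hlim : ∀ t, ∀ᵐ ω ∂P, Tendsto (fun s => V s ω) (𝓝[>] t ⊓ 𝓟 D) (𝓝 (V' t ω))) :
    (∀ t, ∫⁻ ω, V' t ω ∂P ≤ 1) ∧ ∀ s t, s ≤ t → ∀ A, MeasurableSet[ℱ s] A →
      ∫⁻ ω in A, V' t ω ∂P ≤ ∫⁻ ω in A, V' s ω ∂P := by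
  have hne : ∀ t : ℝ≥0, (𝓝[>] t ⊓ 𝓟 D).NeBot := by
    intro t
    rw [((nhdsGT_basis t).inf_principal D).neBot_iff]
    intro u hu
    obtain ⟨s, hs, h1, h2⟩ := hD t u hu
    exact ⟨s, ⟨h1, h2⟩, hs⟩
  have hgt : ∀ t : ℝ≥0, ∀ᶠ s in 𝓝[>] t ⊓ 𝓟 D, t < s := fun t =>
    mem_inf_of_left self_mem_nhdsWithin
  have hdom : ∀ (t : ℝ≥0) (A : Set Ω) (N : ℕ), Tendsto (fun s => ∫⁻ ω in A, min (V s ω) N ∂P)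
      (𝓝[>] t ⊓ 𝓟 D) (𝓝 (∫⁻ ω in A, min (V' t ω) N ∂P)) := by
    intro t A N
    refine tendsto_lintegral_filter_of_dominated_convergence (fun _ => (N : ℝ≥0∞)) ?_ ?_ ?_ ?_
    · filter_upwards [hgt t] with s hs
      exact ((hV s (lt_of_le_of_lt zero_le hs)).mono (ℱ.le s) le_rfl).min measurable_const
    · exact Eventually.of_forall fun s => Eventually.of_forall fun ω => min_le_right _ _
    · rw [lintegral_const]
      exact ENNReal.mul_ne_top (by simp) (measure_ne_top _ _)
    · refine ae_restrict_of_ae ?_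
      filter_upwards [hlim t] with ω hω
      exact hω.min tendsto_const_nhds
  have hmon : ∀ (t : ℝ≥0) (A : Set Ω) (C : ℝ≥0∞), (∀ N : ℕ, ∫⁻ ω in A, min (V' t ω) N ∂P ≤ C) →
      ∫⁻ ω in A, V' t ω ∂P ≤ C := by
    intro t A C h
    have e : ∀ ω, V' t ω = ⨆ N : ℕ, min (V' t ω) N := by
      intro ω
      rw [← inf_iSup_eq, ENNReal.iSup_natCast]
      simp
    rw [lintegral_congr e, lintegral_iSup]
    · exact iSup_le h
    · exact fun N => (hV' t).min measurable_const
    · intro N N' hN ω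
      exact min_le_min_left _ (by exact_mod_cast hN)
  constructor
  · intro t
    rw [← setLIntegral_univ]
    refine hmon t univ 1 fun N => ?_
    refine le_of_tendsto (hdom t univ N) ?_
    filter_upwards [hgt t] with s hs
    rw [setLIntegral_univ]
    exact (lintegral_mono fun ω => min_le_left _ _).trans (hone s (lt_of_le_of_lt zero_le hs))
  · intro s t hst A hA
    rcases hst.eq_or_lt with rfl | hst
    · exact le_rfl
    refine hmon t A _ fun N => ?_
    refine le_trans ?_ (lintegral_mono fun ω => min_le_left _ (N : ℝ≥0∞))
    refine le_of_tendsto (hdom t A N) ?_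
    filter_upwards [hgt t] with t' ht'
    refine ge_of_tendsto (hdom s A N) ?_
    have h2 : ∀ᶠ s' in 𝓝[>] s ⊓ 𝓟 D, s' < t := by
      refine mem_inf_of_left ?_
      filter_upwards [Ioo_mem_nhdsGT hst] with x hx using hx.2
    filter_upwards [hgt s, h2] with s' hs' hs't
    have h0 : 0 < s' := lt_of_le_of_lt zero_le hs'
    exact trunc_le (ℱ.le s') (hV s' h0) (hsup s' t' h0 (hs't.trans ht')) N A (ℱ.mono hs'.le _ hA)

lemma to_super {W : ℝ≥0 → Ω → ℝ} (hW : ∀ t, Measurable[ℱ t] (W t)) (h0 : ∀ t ω, 0 ≤ W t ω)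
    (h1 : ∀ t, ∫⁻ ω, ENNReal.ofReal (W t ω) ∂P ≤ 1)
    (hsup : ∀ s t, s ≤ t → ∀ A, MeasurableSet[ℱ s] A →
      ∫⁻ ω in A, ENNReal.ofReal (W t ω) ∂P ≤ ∫⁻ ω in A, ENNReal.ofReal (W s ω) ∂P) :
    Supermartingale W ℱ P := by
  have hm : ∀ t, Measurable (W t) := fun t => (hW t).mono (ℱ.le t) le_rfl
  have hintg : ∀ t, Integrable (W t) P := by
    intro t
    refine ⟨(hm t).aestronglyMeasurable, ?_⟩
    rw [hasFiniteIntegral_iff_ofReal (Eventually.of_forall (h0 t))]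
    exact (h1 t).trans_lt ENNReal.one_lt_top
  have := submartingale_of_setIntegral_le (μ := P) (ℱ := ℱ) (f := -W)
    (fun t => (hW t).stronglyMeasurable.neg) (fun t => (hintg t).neg) ?_
  · simpa using this.neg
  · intro s t hst A hA
    simp only [Pi.neg_apply, integral_neg, neg_le_neg_iff]
    rw [integral_eq_lintegral_of_nonneg_ae (Eventually.of_forall (h0 t))
      (hm t).aestronglyMeasurable, integral_eq_lintegral_of_nonneg_ae
      (Eventually.of_forall (h0 s)) (hm s).aestronglyMeasurable]
    refine ENNReal.toReal_mono ?_ (hsup s t hst A hA)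
    exact ne_top_of_le_ne_top ENNReal.one_ne_top ((setLIntegral_le_lintegral _ _).trans (h1 s))

/-- comparison with the conditional expectation -/
lemma condExp_le_of {G : MeasurableSpace Ω} (hG : G ≤ m) {g : Ω → ℝ} (hg : Integrable g P)
    (hg0 : ∀ ω, 0 ≤ g ω) {L : Ω → ℝ≥0∞} (hL : Measurable[G] L)
    (h : ∀ A, MeasurableSet[G] A → ∫⁻ ω in A, ENNReal.ofReal (g ω) ∂P ≤ ∫⁻ ω in A, L ω ∂P) :
    ∀ᵐ ω ∂P, ENNReal.ofReal ((P[g | G]) ω) ≤ L ω := by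
  have hc : Measurable[G] (fun ω => ENNReal.ofReal ((P[g | G]) ω)) :=
    (stronglyMeasurable_condExp (m := G) (μ := P) (f := g)).measurable.ennreal_ofReal
  refine ae_le_of_ae_le_trim (hm := hG) ?_
  refine ae_le_of_forall_setLIntegral_le_of_sigmaFinite hc ?_
  intro A hA _
  rw [setLIntegral_trim hG hc hA, setLIntegral_trim hG hL hA]
  refine le_trans (le_of_eq ?_) (h A hA)
  have h0 : 0 ≤ᵐ[P] P[g | G] := condExp_nonneg (Eventually.of_forall hg0)
  rw [← ofReal_integral_eq_lintegral_ofReal integrable_condExp.integrableOn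
    (ae_restrict_of_ae h0), setIntegral_condExp hG hg hA,
    ofReal_integral_eq_lintegral_ofReal hg.integrableOn
    (ae_restrict_of_ae (Eventually.of_forall hg0))]

lemma condExp_pos {G : MeasurableSpace Ω} (hG : G ≤ m) {g : Ω → ℝ} (hg : Integrable g P)
    (hg0 : ∀ ω, 0 < g ω) : ∀ᵐ ω ∂P, 0 < (P[g | G]) ω := by
  have hA : MeasurableSet[G] {ω | (P[g | G]) ω ≤ 0} :=
    @measurableSet_le _ _ _ _ _ G _ _ _ _ _
      (stronglyMeasurable_condExp (m := G) (μ := P) (f := g)).measurable measurable_const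
  have h1 : ∫ ω in {ω | (P[g | G]) ω ≤ 0}, g ω ∂P ≤ 0 := by
    rw [← setIntegral_condExp hG hg hA]
    exact setIntegral_nonpos (hG _ hA) fun ω hω => hω
  have h2 : P {ω | (P[g | G]) ω ≤ 0} = 0 := by
    by_contra hne
    have : 0 < ∫ ω in {ω | (P[g | G]) ω ≤ 0}, g ω ∂P := by
      rw [setIntegral_pos_iff_support_of_nonneg_ae
        (Eventually.of_forall fun ω => (hg0 ω).le) hg.integrableOn]
      have : Function.support g = univ := by
        ext ω; simp [(hg0 ω).ne']
      rw [this, univ_inter]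
      exact pos_iff_ne_zero.2 hne
    linarith
  rw [ae_iff]
  simpa using h2

end reg
end Rokhlin

namespace Rokhlin

section fam
variable {Ω : Type*} {m : MeasurableSpace Ω}

/-- The standing assumptions on the family of processes. -/
structure Fam (ℱ : Filtration ℝ≥0 m) (Ys : Set (ℝ≥0 → Ω → ℝ)) : Prop where
  meas : ∀ Y ∈ Ys, ∀ t, Measurable[ℱ t] (Y t)
  nonneg : ∀ Y ∈ Ys, ∀ t ω, 0 ≤ Y t ω
  rc : ∀ Y ∈ Ys, ∀ ω t, ContinuousWithinAt (fun s => Y s ω) (Ici t) t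
  zero : ∀ Y ∈ Ys, ∀ ω, ∀ s t : ℝ≥0, s ≤ t → Y s ω = 0 → Y t ω = 0
  fork : ∀ Y1 ∈ Ys, ∀ Y2 ∈ Ys, ∀ Y3 ∈ Ys, ∀ s : ℝ≥0, 0 < s → ∀ l : Ω → ℝ,
      Measurable[ℱ s] l → (∀ ω, l ω ∈ Icc (0 : ℝ) 1) →
      (fun t ω => if t < s then Y1 t ω
        else Y1 s ω * (l ω * (Y2 t ω / Y2 s ω) + (1 - l ω) * (Y3 t ω / Y3 s ω))) ∈ Ys
  one : (fun _ _ => (1 : ℝ)) ∈ Ys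
  init : ∀ Y ∈ Ys, Y 0 = fun _ => 1

variable {ℱ : Filtration ℝ≥0 m} {Ys : Set (ℝ≥0 → Ω → ℝ)}

lemma Fam.fork_at (h : Fam ℱ Ys) {Y1 Y2 Y3} (h1 : Y1 ∈ Ys) (h2 : Y2 ∈ Ys) (h3 : Y3 ∈ Ys)
    {s : ℝ≥0} (hs : 0 < s) {l : Ω → ℝ} (hl : Measurable[ℱ s] l)
    (hl' : ∀ ω, l ω ∈ Icc (0 : ℝ) 1) :
    ∃ Y ∈ Ys, ∀ t, s ≤ t → ∀ ω, Y t ω =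
      Y1 s ω * (l ω * (Y2 t ω / Y2 s ω) + (1 - l ω) * (Y3 t ω / Y3 s ω)) := by
  refine ⟨_, h.fork Y1 h1 Y2 h2 Y3 h3 s hs l hl hl', ?_⟩
  intro t ht ω
  simp [not_lt.2 ht]

lemma Fam.fork_zero (h : Fam ℱ Ys) {Y1 Y2} (h1 : Y1 ∈ Ys) (h2 : Y2 ∈ Ys)
    {s : ℝ≥0} (hs : 0 < s) :
    ∃ Y ∈ Ys, ∀ t, s ≤ t → ∀ ω, Y t ω = Y1 s ω * (Y2 t ω / Y2 s ω) := by
  obtain ⟨Y, hY, hY'⟩ := h.fork_at h1 h2 h2 hs (l := fun _ => 0) measurable_const (by simp)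
  refine ⟨Y, hY, fun t ht ω => ?_⟩
  rw [hY' t ht ω]; simp

lemma Fam.stopped (h : Fam ℱ Ys) {Y} (hY : Y ∈ Ys) {T : ℝ≥0} (hT : 0 < T) :
    ∃ Y' ∈ Ys, (∀ t, t ≤ T → Y' t = Y t) ∧ ∀ t, T ≤ t → Y' t = Y T := by
  refine ⟨_, h.fork Y hY _ h.one _ h.one T hT (fun _ => 0) measurable_const (by simp), ?_, ?_⟩
  · intro t ht
    ext ω
    rcases ht.eq_or_lt with rfl | ht
    · simp
    · simp [ht]
  · intro t ht
    ext ω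
    simp [not_lt.2 ht]

/-- terminal values -/
def KT (Ys : Set (ℝ≥0 → Ω → ℝ)) : Set (Ω → ℝ) := {X | ∃ Y ∈ Ys, ∃ T : ℝ≥0, 0 < T ∧ X = Y T}

lemma Fam.KT_conv (h : Fam ℱ Ys) : ∀ X ∈ KT Ys, ∀ X' ∈ KT Ys, ∀ θ : ℝ, 0 ≤ θ → θ ≤ 1 →
    ∃ W : ℕ → Ω → ℝ, (∀ n, W n ∈ KT Ys) ∧
      ∀ ω, Tendsto (fun n => W n ω) atTop (𝓝 (θ * X ω + (1 - θ) * X' ω)) := by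
  rintro X ⟨Y, hY, T, hT, rfl⟩ X' ⟨Y', hY', T', hT', rfl⟩ θ h0 h1
  obtain ⟨U, hU, hU1, hU2⟩ := h.stopped hY hT
  obtain ⟨U', hU', hU1', hU2'⟩ := h.stopped hY' hT'
  set S := max T T' with hS
  have hS0 : 0 < S := lt_max_of_lt_left hT
  set s : ℕ → ℝ≥0 := fun n => S / ((n : ℝ≥0) + 1) with hs
  have hs0 : ∀ n, 0 < s n := fun n => div_pos hS0 (by positivity)
  have hsS : ∀ n, s n ≤ S := fun n => div_le_self zero_le (by simp)
  have hst : Tendsto s atTop (𝓝[≥] 0) := by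
    refine tendsto_nhdsWithin_iff.2 ⟨?_, Eventually.of_forall fun n => mem_Ici.2 zero_le⟩
    rw [← NNReal.tendsto_coe]
    have := (tendsto_one_div_add_atTop_nhds_zero_nat (𝕜 := ℝ)).const_mul (S : ℝ)
    simp only [mul_zero] at this
    refine this.congr fun n => ?_
    simp [hs, div_eq_mul_inv]
  have hW : ∀ n, ∃ V ∈ Ys, ∀ t, s n ≤ t → ∀ ω, V t ω =
      1 * (θ * (U t ω / U (s n) ω) + (1 - θ) * (U' t ω / U' (s n) ω)) := by
    intro n
    exact h.fork_at h.one hU hU' (hs0 n) (l := fun _ => θ) measurable_const (fun _ => ⟨h0, h1⟩)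
  choose V hV hV' using hW
  refine ⟨fun n => V n S, fun n => ⟨V n, hV n, S, hS0, rfl⟩, fun ω => ?_⟩
  have hu : ∀ U ∈ Ys, Tendsto (fun n => U (s n) ω) atTop (𝓝 1) := by
    intro U hU
    have := (h.rc U hU ω 0).tendsto
    have h2 := this.comp hst
    simpa [h.init U hU, Function.comp_def] using h2
  have e1 : U S ω = Y T ω := by rw [hU2 S (le_max_left _ _)]
  have e2 : U' S ω = Y' T' ω := by rw [hU2' S (le_max_right _ _)]
  have hlim : Tendsto (fun n => 1 * (θ * (U S ω / U (s n) ω) + (1 - θ) * (U' S ω / U' (s n) ω)))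
      atTop (𝓝 (1 * (θ * (U S ω / 1) + (1 - θ) * (U' S ω / 1)))) := by
    refine Tendsto.const_mul _ (Tendsto.add (Tendsto.const_mul _ ?_) (Tendsto.const_mul _ ?_))
    · exact tendsto_const_nhds.div (hu U hU) one_ne_zero
    · exact tendsto_const_nhds.div (hu U' hU') one_ne_zero
  simp only [div_one, one_mul, e1, e2] at hlim
  refine hlim.congr fun n => ?_
  have := hV' n S (hsS n) ω
  rw [e1, e2, one_mul] at this
  exact this.symm

variable {P : Measure Ω} [IsProbabilityMeasure P]

lemma Fam.exists_g (h : Fam ℱ Ys)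
    (hb : Tendsto (fun M : ℝ =>
        ⨆ X ∈ {X : Ω → ℝ | ∃ Y ∈ Ys, ∀ᵐ ω ∂P, Tendsto (fun t => Y t ω) atTop (𝓝 (X ω))},
        P {ω | M ≤ |X ω|}) atTop (𝓝 0)) :
    ∃ g : Ω → ℝ, Measurable g ∧ (∀ ω, 0 < g ω) ∧ (∀ ω, g ω ≤ 1) ∧
      ∀ Y ∈ Ys, ∀ T : ℝ≥0, 0 < T → ∫⁻ ω, ENNReal.ofReal (g ω * Y T ω) ∂P ≤ 1 := by
  have k1 : ∀ X ∈ KT Ys, Measurable X := by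
    rintro X ⟨Y, hY, T, hT, rfl⟩
    exact (h.meas Y hY T).mono (ℱ.le T) le_rfl
  have k2 : ∀ X ∈ KT Ys, ∀ ω, 0 ≤ X ω := by
    rintro X ⟨Y, hY, T, hT, rfl⟩ ω
    exact h.nonneg Y hY T ω
  have k3 : (KT Ys).Nonempty := ⟨_, _, h.one, 1, one_pos, rfl⟩
  have k4 : ∀ ε : ℝ≥0∞, 0 < ε → ∃ M : ℝ, ∀ X ∈ KT Ys, P {ω | M ≤ X ω} ≤ ε := by
    intro ε hε
    obtain ⟨M, hM⟩ := ((tendsto_order.1 hb).2 ε hε).exists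
    refine ⟨M, ?_⟩
    rintro X ⟨Y, hY, T, hT, rfl⟩
    obtain ⟨Y', hY', -, hs⟩ := h.stopped hY hT
    refine le_trans ?_ hM.le
    refine le_trans (measure_mono fun ω (hω : M ≤ Y T ω) => show M ≤ |Y T ω| from le_trans hω (le_abs_self _)) ?_
    refine le_iSup₂ (f := fun (X : Ω → ℝ) (_ : X ∈ {X : Ω → ℝ | ∃ Y ∈ Ys, ∀ᵐ ω ∂P,
      Tendsto (fun t => Y t ω) atTop (𝓝 (X ω))}) => P {ω | M ≤ |X ω|}) (Y T) ⟨Y', hY', ?_⟩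
    refine Eventually.of_forall fun ω => ?_
    refine tendsto_const_nhds.congr' ?_
    filter_upwards [eventually_ge_atTop T] with t ht
    rw [hs t ht]
  obtain ⟨g, hg, hg0, hg1, hgi⟩ := exists_density (P := P) (KT Ys) k1 k2 k3 h.KT_conv k4
  exact ⟨g, hg, hg0, hg1, fun Y hY T hT => hgi _ ⟨Y, hY, T, hT, rfl⟩⟩

/-- the continuation ratios -/
def Rt (Ys : Set (ℝ≥0 → Ω → ℝ)) (g : Ω → ℝ) (t : ℝ≥0) : Set (Ω → ℝ≥0∞) :=
  {ρ | ∃ Y ∈ Ys, ∃ T, t ≤ T ∧ ρ = fun ω => ENNReal.ofReal (g ω * (Y T ω / Y t ω))}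

lemma Fam.exists_L (h : Fam ℱ Ys) {g : Ω → ℝ} (hg : Measurable g)
    (hgi : ∀ Y ∈ Ys, ∀ T : ℝ≥0, 0 < T → ∫⁻ ω, ENNReal.ofReal (g ω * Y T ω) ∂P ≤ 1)
    {t : ℝ≥0} (ht : 0 < t) :
    ∃ L : Ω → ℝ≥0∞, Measurable[ℱ t] L ∧
      (∀ ρ ∈ Rt Ys g t, ∀ f : Ω → ℝ≥0∞, Measurable[ℱ t] f →
        ∫⁻ ω, f ω * ρ ω ∂P ≤ ∫⁻ ω, f ω * L ω ∂P) ∧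
      (∀ f : Ω → ℝ≥0∞, Measurable[ℱ t] f →
        ∫⁻ ω, f ω * L ω ∂P ≤ ⨆ ρ ∈ Rt Ys g t, ∫⁻ ω, f ω * ρ ω ∂P) := by
  have hm : ∀ Y ∈ Ys, ∀ t, Measurable (Y t) := fun Y hY t => (h.meas Y hY t).mono (ℱ.le t) le_rfl
  refine exists_esssup (ℱ t) (ℱ.le t) _ ?_ ?_ ?_ ?_
  · rintro ρ ⟨Y, hY, T, hT, rfl⟩
    exact (hg.mul ((hm Y hY T).div (hm Y hY t))).ennreal_ofReal
  · exact ⟨_, _, h.one, t, le_rfl, rfl⟩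
  · rintro ρ ⟨Y, hY, T, hT, rfl⟩ ρ' ⟨Y', hY', T', hT', rfl⟩ A hA
    obtain ⟨U, hU, hU1, hU2⟩ := h.stopped hY (ht.trans_le hT)
    obtain ⟨U', hU', hU1', hU2'⟩ := h.stopped hY' (ht.trans_le hT')
    have hl : Measurable[ℱ t] (A.indicator (fun _ => (1 : ℝ))) :=
      (@measurable_const _ _ _ (ℱ t) _).indicator hA
    obtain ⟨V, hV, hV'⟩ := h.fork_at h.one hU hU' ht hl (fun ω => by
      by_cases hω : ω ∈ A <;> simp [hω])
    refine ⟨V, hV, max T T', le_max_of_le_left hT, ?_⟩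
    ext ω
    rw [hV' _ (le_max_of_le_left hT), hV' _ le_rfl, hU2 _ (le_max_left _ _),
      hU2' _ (le_max_right _ _), hU1 t hT, hU1' t hT']
    have hz : ∀ Y ∈ Ys, ∀ T, t ≤ T → Y T ω / Y t ω / (Y t ω / Y t ω) = Y T ω / Y t ω := by
      intro Y hY T hT
      by_cases h0 : Y t ω = 0
      · simp [h0]
      · simp [h0]
    by_cases hω : ω ∈ A
    · simp [hω, hz Y hY T hT]
    · simp [hω, hz Y' hY' T' hT']
  · rintro ρ ⟨Y, hY, T, hT, rfl⟩
    obtain ⟨V, hV, hV'⟩ := h.fork_zero h.one hY ht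
    refine le_trans (le_of_eq ?_) (hgi V hV T (ht.trans_le hT))
    refine lintegral_congr fun ω => ?_
    rw [hV' T hT ω, one_mul]

lemma Fam.L_mul (h : Fam ℱ Ys) {g : Ω → ℝ}
    (hgi : ∀ Y ∈ Ys, ∀ T : ℝ≥0, 0 < T → ∫⁻ ω, ENNReal.ofReal (g ω * Y T ω) ∂P ≤ 1)
    {t : ℝ≥0} (ht : 0 < t) {L : Ω → ℝ≥0∞}
    (hL2 : ∀ f : Ω → ℝ≥0∞, Measurable[ℱ t] f →
        ∫⁻ ω, f ω * L ω ∂P ≤ ⨆ ρ ∈ Rt Ys g t, ∫⁻ ω, f ω * ρ ω ∂P) {Y} (hY : Y ∈ Ys) :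
    ∫⁻ ω, ENNReal.ofReal (Y t ω) * L ω ∂P ≤ 1 := by
  refine (hL2 (fun ω => ENNReal.ofReal (Y t ω)) (h.meas Y hY t).ennreal_ofReal).trans ?_
  refine iSup₂_le ?_
  rintro ρ ⟨Y', hY', T, hT, rfl⟩
  obtain ⟨V, hV, hV'⟩ := h.fork_zero hY hY' ht
  refine le_trans (le_of_eq ?_) (hgi V hV T (ht.trans_le hT))
  refine lintegral_congr fun ω => ?_
  rw [hV' T hT ω, ← ENNReal.ofReal_mul (h.nonneg Y hY t ω)]
  congr 1
  ring

lemma Fam.L_super (h : Fam ℱ Ys) {g : Ω → ℝ}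
    {s t : ℝ≥0} (hs : 0 < s) (hst : s < t) {L K : Ω → ℝ≥0∞}
    (hL2 : ∀ f : Ω → ℝ≥0∞, Measurable[ℱ t] f →
        ∫⁻ ω, f ω * L ω ∂P ≤ ⨆ ρ ∈ Rt Ys g t, ∫⁻ ω, f ω * ρ ω ∂P)
    (hK1 : ∀ ρ ∈ Rt Ys g s, ∀ f : Ω → ℝ≥0∞, Measurable[ℱ s] f →
        ∫⁻ ω, f ω * ρ ω ∂P ≤ ∫⁻ ω, f ω * K ω ∂P) {Y} (hY : Y ∈ Ys)
    {A : Set Ω} (hA : MeasurableSet[ℱ s] A) :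
    ∫⁻ ω in A, ENNReal.ofReal (Y t ω) * L ω ∂P ≤
      ∫⁻ ω in A, ENNReal.ofReal (Y s ω) * K ω ∂P := by
  rw [← lintegral_indicator (ℱ.le s _ hA), ← lintegral_indicator (ℱ.le s _ hA)]
  have e1 : ∀ ω, A.indicator (fun ω => ENNReal.ofReal (Y t ω) * L ω) ω =
      A.indicator (fun ω => ENNReal.ofReal (Y t ω)) ω * L ω := by
    intro ω
    by_cases hω : ω ∈ A <;> simp [hω]
  have e2 : ∀ ω, A.indicator (fun ω => ENNReal.ofReal (Y s ω) * K ω) ω =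
      A.indicator (fun ω => ENNReal.ofReal (Y s ω)) ω * K ω := by
    intro ω
    by_cases hω : ω ∈ A <;> simp [hω]
  rw [lintegral_congr e1, lintegral_congr e2]
  refine (hL2 _ ((h.meas Y hY t).ennreal_ofReal.indicator (ℱ.mono hst.le _ hA))).trans ?_
  refine iSup₂_le ?_
  rintro ρ ⟨Y', hY', T, hT, rfl⟩
  obtain ⟨V, hV, hVs, hV'⟩ : ∃ V ∈ Ys, (∀ ω, V s ω = Y s ω) ∧
      ∀ ω, V T ω = Y t ω * (Y' T ω / Y' t ω) := by
    refine ⟨_, h.fork Y hY Y' hY' Y' hY' t (hs.trans hst) (fun _ => 0) measurable_const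
      (by simp), ?_, ?_⟩
    · intro ω
      simp [hst]
    · intro ω
      simp [not_lt.2 hT]
  refine le_trans (le_of_eq ?_) (hK1 _ ⟨V, hV, T, hst.le.trans hT, rfl⟩ _
    ((h.meas Y hY s).ennreal_ofReal.indicator hA))
  refine lintegral_congr fun ω => ?_
  by_cases hω : ω ∈ A
  swap
  · simp [hω]
  simp only [hω, indicator_of_mem, hVs, hV']
  rw [← ENNReal.ofReal_mul (h.nonneg Y hY t ω), ← ENNReal.ofReal_mul (h.nonneg Y hY s ω)]
  congr 1
  by_cases h0 : Y s ω = 0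
  · have := h.zero Y hY ω s t hst.le h0
    simp [h0, this]
  · field_simp

end fam
end Rokhlin

namespace Rokhlin

section forward
variable {Ω : Type*} {m : MeasurableSpace Ω} {P : Measure Ω} [IsProbabilityMeasure P]
  {ℱ : Filtration ℝ≥0 m} {Ys : Set (ℝ≥0 → Ω → ℝ)}

lemma exists_times : ∃ d : ℕ → ℝ≥0, (∀ n, 0 < d n) ∧
    (∀ u v : ℝ≥0, u < v → ∃ s ∈ range d, u < s ∧ s < v) ∧ ∀ n : ℕ, (n : ℝ≥0) + 1 ∈ range d := by
  obtain ⟨S, hSc, hS⟩ := TopologicalSpace.exists_countable_dense ℝ≥0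
  set D : Set ℝ≥0 := (S ∩ Ioi 0) ∪ range (fun n : ℕ => (n : ℝ≥0) + 1) with hD
  have hDc : D.Countable := (hSc.mono inter_subset_left).union (countable_range _)
  have hDn : D.Nonempty := ⟨_, Or.inr ⟨0, rfl⟩⟩
  obtain ⟨d, hd⟩ := hDc.exists_eq_range hDn
  refine ⟨d, ?_, ?_, ?_⟩
  · intro n
    have : d n ∈ D := hd ▸ mem_range_self n
    rcases this with h | ⟨k, h⟩
    · exact h.2
    · rw [← h]; positivity
  · intro u v huv
    obtain ⟨s, hs, h1, h2⟩ := hS.exists_between huv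
    exact ⟨s, hd ▸ Or.inl ⟨hs, lt_of_le_of_lt zero_le h1⟩, h1, h2⟩
  · intro n
    exact hd ▸ Or.inr ⟨n, rfl⟩

lemma Fam.forward (h : Fam ℱ Ys)
    (hright : ∀ t : ℝ≥0, ℱ t = ⨅ (s : ℝ≥0) (_ : t < s), ℱ s)
    {g : Ω → ℝ} (hg : Measurable g) (hg0 : ∀ ω, 0 < g ω) (hg1 : ∀ ω, g ω ≤ 1)
    (hgi : ∀ Y ∈ Ys, ∀ T : ℝ≥0, 0 < T → ∫⁻ ω, ENNReal.ofReal (g ω * Y T ω) ∂P ≤ 1) :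
    ∃ Z : ℝ≥0 → Ω → ℝ, Supermartingale Z ℱ P ∧ (∀ t ω, 0 ≤ Z t ω) ∧
        (∀ᵐ ω ∂P, (∀ t, ContinuousWithinAt (fun s => Z s ω) (Ici t) t) ∧
          ∀ t : ℝ≥0, 0 < t → ∃ c : ℝ, Tendsto (fun s => Z s ω) (𝓝[<] t) (𝓝 c)) ∧
        (∃ Zinf : Ω → ℝ,
          ∀ᵐ ω ∂P, Tendsto (fun t => Z t ω) atTop (𝓝 (Zinf ω)) ∧ 0 < Zinf ω) ∧
        ∀ Y ∈ Ys, Supermartingale (fun t ω => Y t ω * Z t ω) ℱ P := by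
  have hex : ∀ t : ℝ≥0, ∃ L : Ω → ℝ≥0∞, 0 < t → (Measurable[ℱ t] L ∧
      (∀ ρ ∈ Rt Ys g t, ∀ f : Ω → ℝ≥0∞, Measurable[ℱ t] f →
        ∫⁻ ω, f ω * ρ ω ∂P ≤ ∫⁻ ω, f ω * L ω ∂P) ∧
      (∀ f : Ω → ℝ≥0∞, Measurable[ℱ t] f →
        ∫⁻ ω, f ω * L ω ∂P ≤ ⨆ ρ ∈ Rt Ys g t, ∫⁻ ω, f ω * ρ ω ∂P)) := by
    intro t
    by_cases ht : 0 < t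
    · obtain ⟨L, hL⟩ := h.exists_L hg hgi ht
      exact ⟨L, fun _ => hL⟩
    · exact ⟨0, fun h => absurd h ht⟩
  choose L hL using hex
  have hLm : ∀ t, 0 < t → Measurable[ℱ t] (L t) := fun t ht => (hL t ht).1
  have hYsup : ∀ Y ∈ Ys, ∀ s t, 0 < s → s < t → ∀ A, MeasurableSet[ℱ s] A →
      ∫⁻ ω in A, ENNReal.ofReal (Y t ω) * L t ω ∂P ≤
        ∫⁻ ω in A, ENNReal.ofReal (Y s ω) * L s ω ∂P := by
    intro Y hY s t hs hst A hA
    exact h.L_super hs hst (hL t (hs.trans hst)).2.2 (hL s hs).2.1 hY hA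
  have hYone : ∀ Y ∈ Ys, ∀ t, 0 < t → ∫⁻ ω, ENNReal.ofReal (Y t ω) * L t ω ∂P ≤ 1 := by
    intro Y hY t ht
    exact h.L_mul hgi ht (hL t ht).2.2 hY
  have hLsup : ∀ s t, 0 < s → s < t → ∀ A, MeasurableSet[ℱ s] A →
      ∫⁻ ω in A, L t ω ∂P ≤ ∫⁻ ω in A, L s ω ∂P := by
    simpa using hYsup _ h.one
  have hLone : ∀ t, 0 < t → ∫⁻ ω, L t ω ∂P ≤ 1 := by simpa using hYone _ h.one
  have hgL : ∀ t, 0 < t → ∀ A, MeasurableSet[ℱ t] A →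
      ∫⁻ ω in A, ENNReal.ofReal (g ω) ∂P ≤ ∫⁻ ω in A, L t ω ∂P := by
    intro t ht A hA
    have h1 := (hL t ht).2.1 (fun ω => ENNReal.ofReal (g ω * (1 / 1)))
      ⟨_, h.one, t, le_rfl, rfl⟩ (A.indicator fun _ => 1)
      ((@measurable_const _ _ _ (ℱ t) _).indicator hA)
    rw [← lintegral_indicator (ℱ.le t _ hA), ← lintegral_indicator (ℱ.le t _ hA)]
    refine le_trans (le_of_eq ?_) (h1.trans (le_of_eq ?_))
    · refine lintegral_congr fun ω => ?_
      by_cases hω : ω ∈ A <;> simp [hω]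
    · refine lintegral_congr fun ω => ?_
      by_cases hω : ω ∈ A <;> simp [hω]
  have hgint : Integrable g P := by
    refine Integrable.of_bound hg.aestronglyMeasurable 1 (Eventually.of_forall fun ω => ?_)
    rw [Real.norm_eq_abs, abs_of_pos (hg0 ω)]
    exact hg1 ω
  obtain ⟨d, hd0, hD, hdn⟩ := exists_times
  obtain ⟨Q, hQc, hQ⟩ := TopologicalSpace.exists_countable_dense ℝ≥0∞
  have hgood := ae_goodPath hLm hLsup hLone d hd0 Q hQc
  set r : ℝ≥0 → Ω → ℝ≥0∞ := fun t ω => limsup (fun s => L s ω) (𝓝[>] t ⊓ 𝓟 (range d)) with hr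
  have hrm : ∀ t, Measurable[ℱ t] (r t) := fun t =>
    measurable_limsup hright hLm (range d) (countable_range d) t
  have hreg : ∀ᵐ ω ∂P,
      (∀ t, Tendsto (fun s => L s ω) (𝓝[>] t ⊓ 𝓟 (range d)) (𝓝 (r t ω))) ∧
      (∀ t, r t ω ≠ ∞) ∧
      (∀ t, Tendsto (fun s => (r s ω).toReal) (𝓝[≥] t) (𝓝 (r t ω).toReal)) ∧
      (∀ t, 0 < t → ∃ c, Tendsto (fun s => (r s ω).toReal) (𝓝[<] t) (𝓝 c)) ∧
      ∃ c : ℝ≥0∞, c ≠ ∞ ∧ Tendsto (fun s => L s ω) (atTop ⊓ 𝓟 (range d)) (𝓝 c) ∧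
        Tendsto (fun s => (r s ω).toReal) atTop (𝓝 c.toReal) := by
    filter_upwards [hgood] with ω hω
    exact hω.regular hQ hD
  have hYZ : ∀ Y ∈ Ys, Supermartingale (fun t ω => Y t ω * (r t ω).toReal) ℱ P := by
    intro Y hY
    have hYm : ∀ t, Measurable[ℱ t] (fun ω => ENNReal.ofReal (Y t ω)) := fun t =>
      (h.meas Y hY t).ennreal_ofReal
    obtain ⟨k1, k2⟩ := reg_super (P := P) (ℱ := ℱ) (D := range d)
      (V := fun t ω => ENNReal.ofReal (Y t ω) * L t ω)
      (V' := fun t ω => ENNReal.ofReal (Y t ω) * r t ω) hD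
      (fun t ht => (hYm t).mul (hLm t ht)) (hYsup Y hY) (hYone Y hY)
      (fun t => ((hYm t).mul (hrm t)).mono (ℱ.le t) le_rfl) (by
        intro t
        filter_upwards [hreg] with ω hω
        refine ENNReal.Tendsto.mul ?_ (Or.inr (hω.2.1 t)) (hω.1 t) (Or.inr ENNReal.ofReal_ne_top)
        refine ENNReal.tendsto_ofReal ?_
        refine (h.rc Y hY ω t).tendsto.mono_left ?_
        exact inf_le_left.trans (nhdsWithin_mono _ Ioi_subset_Ici_self))
    have e : ∀ t, ∀ᵐ ω ∂P, ENNReal.ofReal (Y t ω * (r t ω).toReal) =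
        ENNReal.ofReal (Y t ω) * r t ω := by
      intro t
      filter_upwards [hreg] with ω hω
      rw [ENNReal.ofReal_mul (h.nonneg Y hY t ω), ENNReal.ofReal_toReal (hω.2.1 t)]
    refine to_super ?_ ?_ ?_ ?_
    · exact fun t => (h.meas Y hY t).mul (hrm t).ennreal_toReal
    · exact fun t ω => mul_nonneg (h.nonneg Y hY t ω) ENNReal.toReal_nonneg
    · intro t
      rw [lintegral_congr_ae (e t)]
      exact k1 t
    · intro s t hst A hA
      rw [lintegral_congr_ae (ae_restrict_of_ae (e t)), lintegral_congr_ae (ae_restrict_of_ae (e s))]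
      exact k2 s t hst A hA
  refine ⟨fun t ω => (r t ω).toReal, ?_, fun _ _ => ENNReal.toReal_nonneg, ?_, ?_, hYZ⟩
  · simpa using hYZ _ h.one
  · filter_upwards [hreg] with ω hω
    exact ⟨hω.2.2.1, hω.2.2.2.1⟩
  · refine Filter.Eventually.choice (r := fun ω z => Tendsto (fun t => (r t ω).toReal) atTop (𝓝 z) ∧ 0 < z) ?_
    set 𝒢 : Filtration ℕ m := ⟨fun n => ℱ ((n : ℝ≥0) + 1), fun i j hij => ℱ.mono (by gcongr),
      fun n => ℱ.le _⟩ with h𝒢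
    have hlevy := tendsto_ae_condExp (μ := P) (ℱ := 𝒢) g
    have hGle : (⨆ n, 𝒢 n) ≤ m := iSup_le fun n => 𝒢.le n
    have hpos := condExp_pos (P := P) hGle hgint hg0
    have hle : ∀ᵐ ω ∂P, ∀ n : ℕ, ENNReal.ofReal ((P[g | 𝒢 n]) ω) ≤ L ((n : ℝ≥0) + 1) ω := by
      rw [ae_all_iff]
      intro n
      exact condExp_le_of (ℱ.le _) hgint (fun ω => (hg0 ω).le) (hLm _ (by positivity))
        (hgL _ (by positivity))
    filter_upwards [hreg, hlevy, hpos, hle] with ω h1 h2 h3 h4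
    obtain ⟨c, hc, hc1, hc2⟩ := h1.2.2.2.2
    refine ⟨c.toReal, hc2, ENNReal.toReal_pos ?_ hc⟩
    have hseq : Tendsto (fun n : ℕ => (n : ℝ≥0) + 1) atTop (atTop ⊓ 𝓟 (range d)) := by
      refine tendsto_inf.2 ⟨?_, tendsto_principal.2 (Eventually.of_forall hdn)⟩
      refine tendsto_atTop_mono (f := fun n : ℕ => (n : ℝ≥0)) (fun n => ?_)
        tendsto_natCast_atTop_atTop
      exact le_self_add
    have h5 := le_of_tendsto_of_tendsto' (ENNReal.tendsto_ofReal h2) (hc1.comp hseq) h4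
    exact (lt_of_lt_of_le (ENNReal.ofReal_pos.2 h3) h5).ne'

lemma Fam.backward (h : Fam ℱ Ys) {Z : ℝ≥0 → Ω → ℝ} (hZ : Supermartingale Z ℱ P)
    (hZ0 : ∀ t ω, 0 ≤ Z t ω) {Zinf : Ω → ℝ}
    (hlim : ∀ᵐ ω ∂P, Tendsto (fun t => Z t ω) atTop (𝓝 (Zinf ω)) ∧ 0 < Zinf ω)
    (hYZ : ∀ Y ∈ Ys, Supermartingale (fun t ω => Y t ω * Z t ω) ℱ P) :
    Tendsto (fun M : ℝ =>
        ⨆ X ∈ {X : Ω → ℝ | ∃ Y ∈ Ys, ∀ᵐ ω ∂P, Tendsto (fun t => Y t ω) atTop (𝓝 (X ω))},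
        P {ω | M ≤ |X ω|}) atTop (𝓝 0) := by
  have hnat : Tendsto (fun n : ℕ => (n : ℝ≥0)) atTop atTop := tendsto_natCast_atTop_atTop
  have hZm : ∀ t, AEMeasurable (Z t) P := fun t => (hZ.integrable t).aemeasurable
  have hZim : AEMeasurable Zinf P := by
    refine aemeasurable_of_tendsto_metrizable_ae' (f := fun n : ℕ => Z n) (fun n => hZm n) ?_
    filter_upwards [hlim] with ω hω
    exact hω.1.comp hnat
  set C : ℝ≥0∞ := ∫⁻ ω, ENNReal.ofReal (Z 0 ω) ∂P with hC
  have hCfin : C ≠ ∞ := by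
    have := (hZ.integrable 0).2
    rw [hasFiniteIntegral_iff_ofReal (Eventually.of_forall (hZ0 0))] at this
    exact this.ne
  -- uniform integral bound
  have hintg : ∀ X : Ω → ℝ, (∃ Y ∈ Ys, ∀ᵐ ω ∂P, Tendsto (fun t => Y t ω) atTop (𝓝 (X ω))) →
      (∀ᵐ ω ∂P, 0 ≤ X ω) ∧ AEMeasurable X P ∧ ∫⁻ ω, ENNReal.ofReal (X ω * Zinf ω) ∂P ≤ C := by
    rintro X ⟨Y, hY, hX⟩
    have hYm : ∀ t, Measurable (Y t) := fun t => (h.meas Y hY t).mono (ℱ.le t) le_rfl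
    refine ⟨?_, ?_, ?_⟩
    · filter_upwards [hX] with ω hω
      exact ge_of_tendsto' hω fun t => h.nonneg Y hY t ω
    · refine aemeasurable_of_tendsto_metrizable_ae' (f := fun n : ℕ => Y n)
        (fun n => (hYm n).aemeasurable) ?_
      filter_upwards [hX] with ω hω
      exact hω.comp hnat
    · have hb : ∀ t, ∫⁻ ω, ENNReal.ofReal (Y t ω * Z t ω) ∂P ≤ C := by
        intro t
        have hn : ∀ t ω, 0 ≤ Y t ω * Z t ω := fun t ω => mul_nonneg (h.nonneg Y hY t ω) (hZ0 t ω)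
        have k := (hYZ Y hY).setIntegral_le (zero_le (a := t)) (@MeasurableSet.univ _ (ℱ 0))
        simp only [setIntegral_univ] at k
        rw [← ofReal_integral_eq_lintegral_ofReal ((hYZ Y hY).integrable t)
          (Eventually.of_forall (hn t)), hC, ← ofReal_integral_eq_lintegral_ofReal (hZ.integrable 0)
          (Eventually.of_forall (hZ0 0))]
        refine ENNReal.ofReal_le_ofReal (k.trans (le_of_eq ?_))
        simp [h.init Y hY]
      calc ∫⁻ ω, ENNReal.ofReal (X ω * Zinf ω) ∂P
          = ∫⁻ ω, liminf (fun n : ℕ => ENNReal.ofReal (Y n ω * Z n ω)) atTop ∂P := by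
            refine lintegral_congr_ae ?_
            filter_upwards [hX, hlim] with ω h1 h2
            refine (Tendsto.liminf_eq ?_).symm
            exact ENNReal.tendsto_ofReal ((h1.mul h2.1).comp hnat)
        _ ≤ liminf (fun n : ℕ => ∫⁻ ω, ENNReal.ofReal (Y n ω * Z n ω) ∂P) atTop :=
            lintegral_liminf_le' fun n => ((hYm n).aemeasurable.mul (hZm n)).ennreal_ofReal
        _ ≤ C := liminf_le_of_le ⟨0, by simp⟩ (fun b hb' => by
            obtain ⟨n, hn⟩ := hb'.exists
            exact hn.trans (hb n))
  -- small values of the limit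
  have hsmall : ∀ ε : ℝ≥0∞, 0 < ε → ∃ δ : ℝ, 0 < δ ∧ P {ω | Zinf ω < δ} < ε := by
    intro ε hε
    have ht : Tendsto (fun n : ℕ => P {ω | Zinf ω < 1 / ((n : ℝ) + 1)}) atTop
        (𝓝 (P (⋂ n : ℕ, {ω | Zinf ω < 1 / ((n : ℝ) + 1)}))) := by
      refine tendsto_measure_iInter_atTop ?_ ?_ ⟨0, measure_ne_top _ _⟩
      · intro n
        exact nullMeasurableSet_lt hZim aemeasurable_const
      · intro i j hij ω hω
        have h1 : Zinf ω < 1 / ((j : ℝ) + 1) := hω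
        have h2 : (i : ℝ) ≤ j := by exact_mod_cast hij
        have h3 : 1 / ((j : ℝ) + 1) ≤ 1 / ((i : ℝ) + 1) :=
          one_div_le_one_div_of_le (by positivity) (by linarith)
        exact lt_of_lt_of_le h1 h3
    have h0 : P (⋂ n : ℕ, {ω | Zinf ω < 1 / ((n : ℝ) + 1)}) = 0 := by
      have : ∀ᵐ ω ∂P, 0 < Zinf ω := hlim.mono fun ω hω => hω.2
      refine measure_mono_null ?_ (ae_iff.1 this)
      intro ω hω hpos
      obtain ⟨n, hn⟩ := exists_nat_one_div_lt hpos
      exact lt_asymm hn (mem_iInter.1 hω n)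
    rw [h0] at ht
    obtain ⟨n, hn⟩ := ((tendsto_order.1 ht).2 ε hε).exists
    exact ⟨_, by positivity, hn⟩
  rw [ENNReal.tendsto_nhds_zero]
  intro ε hε
  obtain ⟨δ, hδ, hδε⟩ := hsmall (ε / 2) (ENNReal.half_pos hε.ne')
  have hdiv : Tendsto (fun M : ℝ => C / ENNReal.ofReal (δ * M)) atTop (𝓝 0) := by
    have h1 : Tendsto (fun M : ℝ => ENNReal.ofReal (δ * M)) atTop (𝓝 ∞) :=
      ENNReal.tendsto_ofReal_nhds_top.2 (tendsto_id.const_mul_atTop hδ)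
    have := ENNReal.Tendsto.const_div h1 (Or.inr hCfin)
    simpa using this
  filter_upwards [(tendsto_order.1 hdiv).2 (ε / 2) (ENNReal.half_pos hε.ne'),
    eventually_gt_atTop 0] with M hM hM0
  refine iSup₂_le fun X hX => ?_
  obtain ⟨hX0, hXm, hXi⟩ := hintg X hX
  have hmark : P {ω | ENNReal.ofReal (δ * M) ≤ ENNReal.ofReal (X ω * Zinf ω)} ≤
      C / ENNReal.ofReal (δ * M) := by
    refine (meas_ge_le_lintegral_div (hXm.mul hZim).ennreal_ofReal ?_ ENNReal.ofReal_ne_top).trans ?_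
    · exact (ENNReal.ofReal_pos.2 (mul_pos hδ hM0)).ne'
    · exact ENNReal.div_le_div_right hXi _
  calc P {ω | M ≤ |X ω|}
      ≤ P ({ω | ENNReal.ofReal (δ * M) ≤ ENNReal.ofReal (X ω * Zinf ω)} ∪ {ω | Zinf ω < δ}) := by
        refine measure_mono_ae ?_
        filter_upwards [hX0] with ω h0 hω
        have hω' : M ≤ |X ω| := hω
        rw [abs_of_nonneg h0] at hω'
        by_cases hz : Zinf ω < δ
        · exact Or.inr hz
        · refine Or.inl (ENNReal.ofReal_le_ofReal ?_)
          rw [mul_comm δ M]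
          exact mul_le_mul hω' (not_lt.1 hz) hδ.le h0
    _ ≤ _ := measure_union_le _ _
    _ ≤ ε / 2 + ε / 2 := add_le_add (hmark.trans hM.le) hδε.le
    _ = ε := ENNReal.add_halves ε

end forward
end Rokhlin

/-- (Rokhlin's theorem.) Let `𝒴` be a fork-convex family of adapted,
nonnegative, right-continuous processes containing the constant process `1` with `Y₀ = 1`
for all `Y ∈ 𝒴`, and let `𝒦` be the set of almost sure limits `lim_{t→∞} Y_t` of members of
`𝒴` for which the limit exists. Then `𝒦` is bounded in probability if and only if there
exists a supermartingale density for `𝒴`. -/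
theorem statement8 {Ω : Type*} {m : MeasurableSpace Ω} (P : Measure Ω) [IsProbabilityMeasure P]
    (ℱ : Filtration ℝ≥0 m)
    (hright : ∀ t : ℝ≥0, ℱ t = ⨅ (s : ℝ≥0) (_ : t < s), ℱ s)
    (𝒴 : Set (ℝ≥0 → Ω → ℝ))
    (hadapted : ∀ Y ∈ 𝒴, Adapted ℱ Y)
    (hnonneg : ∀ Y ∈ 𝒴, ∀ t ω, 0 ≤ Y t ω)
    (hrc : ∀ Y ∈ 𝒴, ∀ ω t, ContinuousWithinAt (fun s => Y s ω) (Ici t) t)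
    (hzero : ∀ Y ∈ 𝒴, ∀ ω, ∀ s t : ℝ≥0, s ≤ t → Y s ω = 0 → Y t ω = 0)
    (hfork : ∀ Y1 ∈ 𝒴, ∀ Y2 ∈ 𝒴, ∀ Y3 ∈ 𝒴, ∀ s : ℝ≥0, 0 < s → ∀ l : Ω → ℝ,
      Measurable[ℱ s] l → (∀ ω, l ω ∈ Icc (0 : ℝ) 1) →
      (fun t ω => if t < s then Y1 t ω
        else Y1 s ω * (l ω * (Y2 t ω / Y2 s ω) + (1 - l ω) * (Y3 t ω / Y3 s ω))) ∈ 𝒴)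
    (hone : (fun _ _ => (1 : ℝ)) ∈ 𝒴)
    (hinit : ∀ Y ∈ 𝒴, Y 0 = fun _ => 1) :
    Tendsto (fun M : ℝ =>
        ⨆ X ∈ {X : Ω → ℝ | ∃ Y ∈ 𝒴, ∀ᵐ ω ∂P, Tendsto (fun t => Y t ω) atTop (𝓝 (X ω))},
        P {ω | M ≤ |X ω|}) atTop (𝓝 0) ↔
      ∃ Z : ℝ≥0 → Ω → ℝ, Supermartingale Z ℱ P ∧ (∀ t ω, 0 ≤ Z t ω) ∧
        (∀ᵐ ω ∂P, (∀ t, ContinuousWithinAt (fun s => Z s ω) (Ici t) t) ∧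
          ∀ t : ℝ≥0, 0 < t → ∃ c : ℝ, Tendsto (fun s => Z s ω) (𝓝[<] t) (𝓝 c)) ∧
        (∃ Zinf : Ω → ℝ,
          ∀ᵐ ω ∂P, Tendsto (fun t => Z t ω) atTop (𝓝 (Zinf ω)) ∧ 0 < Zinf ω) ∧
        ∀ Y ∈ 𝒴, Supermartingale (fun t ω => Y t ω * Z t ω) ℱ P := by
  have h : Rokhlin.Fam ℱ 𝒴 := ⟨hadapted, hnonneg, hrc, hzero, hfork, hone, hinit⟩
  constructor
  · intro hb
    obtain ⟨g, hg, hg0, hg1, hgi⟩ := h.exists_g hb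
    exact h.forward hright hg hg0 hg1 hgi
  · rintro ⟨Z, hZ, hZ0, -, ⟨Zinf, hlim⟩, hYZ⟩
    exact h.backward hZ hZ0 hlim hYZ
end

section
/- Let (Ω, F, (F_t)_{t≥0}, P) be a filtered probability space with right-continuous filtration, let L be a random variable with values in a standard Borel space (𝕃, ℒ), and let G⁰_t = F_t ∨ σ(L) and G_t = ⋂_{s>t} G⁰_s be the right-continuous regularization of the initially enlarged filtration. Let P_t(ω, dℓ) denote a regular conditional distribution of L given F_t and let P_L be the law of L. Assume Jacod's criterion: for every t ≥ 0, P-almost surely P_t(ω, ·) ≪ P_L. Then there exists a universal supermartingale density for (G_t): an adapted (with respect to (G_t)), almost surely càdlàg process Z with P(Z_t > 0) = 1 for all t ≥ 0, such that ZM is a (G_t)-supermartingale for every nonnegative (F_t)-supermartingale M. -/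
open MeasureTheory Filter Set
open scoped ENNReal NNReal Topology

noncomputable section Helpers

/-- Dyadic numbers at level `k`. -/
def dy (k i : ℕ) : ℝ≥0 := (i : ℝ≥0) / 2 ^ k

/-- The set of dyadic numbers. -/
def Dy : Set ℝ≥0 := {x | ∃ k i, x = dy k i}

/-- A dyadic sequence converging to `t` strictly from the right. -/
def qs (t : ℝ≥0) (n : ℕ) : ℝ≥0 := dy n (⌊t * 2 ^ n⌋₊ + 1)

lemma dy_mem (k i : ℕ) : dy k i ∈ Dy := ⟨k, i, rfl⟩

lemma qs_mem (t : ℝ≥0) (n : ℕ) : qs t n ∈ Dy := ⟨_, _, rfl⟩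

lemma Dy_countable : Dy.Countable := by
  have : Dy = ⋃ k, Set.range (dy k) := by
    ext x; simp [Dy, eq_comm]
  rw [this]
  exact countable_iUnion fun k => countable_range _

lemma dy_le_iff (k i j : ℕ) : dy k i ≤ dy k j ↔ i ≤ j := by
  unfold dy
  rw [div_le_div_iff_of_pos_right (by positivity)]
  exact_mod_cast Iff.rfl

lemma dy_lt_iff (k i j : ℕ) : dy k i < dy k j ↔ i < j := by
  rw [← not_le, dy_le_iff, not_le]

lemma dy_add (k l i : ℕ) : dy k i = dy (k + l) (i * 2 ^ l) := by
  unfold dy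
  push_cast
  rw [pow_add, mul_div_mul_right]
  positivity

lemma dy_nat (k N : ℕ) : dy k (N * 2 ^ k) = N := by
  unfold dy
  push_cast
  field_simp

lemma Dy_eventually {x : ℝ≥0} (hx : x ∈ Dy) : ∀ᶠ k in atTop, ∃ i, x = dy k i := by
  obtain ⟨k, i, rfl⟩ := hx
  filter_upwards [eventually_ge_atTop k] with n hn
  obtain ⟨l, rfl⟩ := Nat.exists_eq_add_of_le hn
  exact ⟨_, dy_add k l i⟩

lemma lt_qs (t : ℝ≥0) (n : ℕ) : t < qs t n := by
  unfold qs dy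
  rw [lt_div_iff₀ (by positivity)]
  push_cast
  exact Nat.lt_floor_add_one _

lemma qs_le (t : ℝ≥0) (n : ℕ) : qs t n ≤ t + 1 / 2 ^ n := by
  unfold qs dy
  rw [div_le_iff₀ (by positivity), add_mul]
  push_cast
  have h : (1 : ℝ≥0) / 2 ^ n * 2 ^ n = 1 := by field_simp
  rw [h]
  gcongr
  exact Nat.floor_le (by positivity)

lemma qs_tendsto (t : ℝ≥0) : Tendsto (qs t) atTop (𝓝 t) := by
  have h : Tendsto (fun n : ℕ => t + 1 / 2 ^ n) atTop (𝓝 (t + 0)) := by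
    refine tendsto_const_nhds.add ?_
    have := NNReal.tendsto_pow_atTop_nhds_zero_of_lt_one (r := 1 / 2) (by
      rw [div_lt_iff₀ (by norm_num)]; norm_num)
    simpa using this
  rw [add_zero] at h
  exact tendsto_of_tendsto_of_tendsto_of_le_of_le tendsto_const_nhds h
    (fun n => (lt_qs t n).le) (qs_le t)

lemma qs_tendsto' (t : ℝ≥0) : Tendsto (qs t) atTop (𝓝[>] t ⊓ 𝓟 Dy) := by
  refine tendsto_inf.2 ⟨tendsto_nhdsWithin_iff.2 ⟨qs_tendsto t, ?_⟩, tendsto_principal.2 ?_⟩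
  · exact Eventually.of_forall fun n => lt_qs t n
  · exact Eventually.of_forall fun n => qs_mem t n

instance right_neBot (t : ℝ≥0) : (𝓝[>] t ⊓ 𝓟 Dy).NeBot := (qs_tendsto' t).neBot

/-- Alternation predicate: `n` upcrossings of `(a,b)` along dyadics below `hi`. -/
def Alt (f : ℝ≥0 → ℝ) (a b : ℝ) (lo : ℝ≥0) : ℕ → ℝ≥0 → Prop
  | 0, hi => lo ≤ hi
  | n + 1, hi => ∃ x ∈ Dy, ∃ y ∈ Dy, Alt f a b lo n x ∧ f x < a ∧ x ≤ y ∧ b < f y ∧ y < hi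

lemma Alt.mono {f : ℝ≥0 → ℝ} {a b : ℝ} {lo : ℝ≥0} {n : ℕ} {hi hi' : ℝ≥0} (h : hi ≤ hi')
    (H : Alt f a b lo n hi) : Alt f a b lo n hi' := by
  cases n with
  | zero => exact le_trans H h
  | succ n =>
    obtain ⟨x, hx, y, hy, h1, h2, h3, h4, h5⟩ := H
    exact ⟨x, hx, y, hy, h1, h2, h3, h4, h5.trans_le h⟩

lemma Alt.prepend {f : ℝ≥0 → ℝ} {a b : ℝ} {x y mid : ℝ≥0} (hx : x ∈ Dy) (hy : y ∈ Dy)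
    (hfx : f x < a) (hfy : b < f y) (hxy : x ≤ y) (hym : y < mid) {n : ℕ} :
    ∀ {hi : ℝ≥0}, Alt f a b mid n hi → Alt f a b x (n + 1) hi := by
  induction n with
  | zero =>
    intro hi H
    exact ⟨x, hx, y, hy, le_refl x, hfx, hxy, hfy, hym.trans_le H⟩
  | succ n ih =>
    rintro hi ⟨x', hx', y', hy', h1, h2, h3, h4, h5⟩
    exact ⟨x', hx', y', hy', ih h1, h2, h3, h4, h5⟩

lemma Alt.lo_mono {f : ℝ≥0 → ℝ} {a b : ℝ} {lo lo' : ℝ≥0} (hl : lo' ≤ lo) {n : ℕ} :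
    ∀ {hi : ℝ≥0}, Alt f a b lo n hi → Alt f a b lo' n hi := by
  induction n with
  | zero =>
    intro hi H
    exact le_trans hl H
  | succ n ih =>
    rintro hi ⟨x', hx', y', hy', h1, h2, h3, h4, h5⟩
    exact ⟨x', hx', y', hy', ih h1, h2, h3, h4, h5⟩

lemma alt_right {f : ℝ≥0 → ℝ} {a b : ℝ} {t : ℝ≥0}
    (ha : ∃ᶠ s in 𝓝[>] t ⊓ 𝓟 Dy, f s < a) (hb : ∃ᶠ s in 𝓝[>] t ⊓ 𝓟 Dy, b < f s) (s : ℝ≥0)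
    (hs : t < s) (n : ℕ) : ∃ lo, t < lo ∧ Alt f a b lo n s := by
  have key : ∀ r, t < r → ∀ᶠ x in 𝓝[>] t ⊓ 𝓟 Dy, t < x ∧ x < r ∧ x ∈ Dy := by
    intro r hr
    have h1 : ∀ᶠ x in 𝓝[>] t, x ∈ Ioo t r := Ioo_mem_nhdsGT hr
    rw [eventually_inf_principal]
    filter_upwards [h1] with x hx hxD
    exact ⟨hx.1, hx.2, hxD⟩
  induction n with
  | zero => exact ⟨s, hs, le_refl s⟩
  | succ n ih =>
    obtain ⟨mid, hm, H⟩ := ih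
    obtain ⟨y, hy, hy1, hy2, hy3⟩ := (hb.and_eventually (key mid hm)).exists
    obtain ⟨x, hx, hx1, hx2, hx3⟩ := (ha.and_eventually (key y hy1)).exists
    exact ⟨x, hx1, H.prepend hx3 hy3 hx hy hx2.le hy2⟩

lemma alt_left {f : ℝ≥0 → ℝ} {a b : ℝ} {t : ℝ≥0} (ht : 0 < t)
    (ha : ∃ᶠ s in 𝓝[<] t ⊓ 𝓟 Dy, f s < a) (hb : ∃ᶠ s in 𝓝[<] t ⊓ 𝓟 Dy, b < f s)
    (n : ℕ) : ∃ hi, hi < t ∧ Alt f a b 0 n hi := by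
  have key : ∀ r, r < t → ∀ᶠ x in 𝓝[<] t ⊓ 𝓟 Dy, r < x ∧ x < t ∧ x ∈ Dy := by
    intro r hr
    have h1 : ∀ᶠ x in 𝓝[<] t, x ∈ Ioo r t := Ioo_mem_nhdsLT hr
    rw [eventually_inf_principal]
    filter_upwards [h1] with x hx hxD
    exact ⟨hx.1, hx.2, hxD⟩
  induction n with
  | zero => exact ⟨0, ht, le_refl _⟩
  | succ n ih =>
    obtain ⟨hi, hm, H⟩ := ih
    obtain ⟨x, hx, hx1, hx2, hx3⟩ := (ha.and_eventually (key hi hm)).exists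
    obtain ⟨y, hy, hy1, hy2, hy3⟩ := (hb.and_eventually (key x hx2)).exists
    obtain ⟨z, hz1, hz2⟩ := exists_between hy2
    exact ⟨z, hz2, x, hx3, y, hy3, H.mono hx1.le, hx, hy1.le, hy, hz1⟩

lemma alt_upcrossings {Ω : Type*} {X : ℝ≥0 → Ω → ℝ} {ω : Ω} {a b : ℝ} (hab : a < b) {lo : ℝ≥0}
    {n : ℕ} : ∀ {hi : ℝ≥0}, Alt (fun s => X s ω) a b lo n hi →
      ∀ᶠ k in atTop, ∀ i, hi ≤ dy k i →
        n ≤ upcrossingsBefore a b (fun j ω => X (dy k j) ω) i ω := by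
  induction n with
  | zero => intro hi _; exact Eventually.of_forall fun k i _ => Nat.zero_le _
  | succ n ih =>
    rintro hi ⟨x, hx, y, hy, h1, h2, h3, h4, h5⟩
    filter_upwards [Dy_eventually hx, Dy_eventually hy, ih h1] with k hkx hky hk i hi
    obtain ⟨ix, hix⟩ := hkx
    obtain ⟨iy, hiy⟩ := hky
    have e1 := hk ix hix.le
    have hxy : ix ≤ iy := by rw [hix, hiy, dy_le_iff] at h3; exact h3
    have hyi : iy < i := by
      have := h5.trans_le hi
      rw [hiy, dy_lt_iff] at this; exact this
    have e2 := upcrossingsBefore_lt_of_exists_upcrossing (a := a) (b := b)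
      (f := (fun j ω => X (dy k j) ω)) (ω := ω) (N := ix) hab (le_refl ix)
      (by simpa [← hix] using h2) hxy (by simpa [← hiy] using h4)
    have e3 := upcrossingsBefore_mono (f := (fun j ω => X (dy k j) ω)) hab
      (Nat.succ_le_of_lt hyi) ω
    simp only [Nat.succ_eq_add_one] at e3
    omega

/-- Sampling a filtration along a dyadic grid. -/
def gridFil {Ω : Type*} {m : MeasurableSpace Ω} (H : Filtration ℝ≥0 m) (k : ℕ) :
    Filtration ℕ m where
  seq i := H (dy k i)
  mono' i j hij := H.mono ((dy_le_iff k i j).2 hij)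
  le' i := H.le _

lemma grid_sub {Ω : Type*} {m : MeasurableSpace Ω} {P : Measure Ω} {H : Filtration ℝ≥0 m}
    {X : ℝ≥0 → Ω → ℝ} (hX : Supermartingale X H P) (k : ℕ) :
    Supermartingale (fun i => X (dy k i)) (gridFil H k) P :=
  ⟨fun i => hX.1 _, fun i j hij => hX.2.1 _ _ ((dy_le_iff k i j).2 hij), fun i => hX.2.2 _⟩

lemma ae_no_alt {Ω : Type*} {m : MeasurableSpace Ω} {P : Measure Ω} [IsProbabilityMeasure P]
    {H : Filtration ℝ≥0 m} {X : ℝ≥0 → Ω → ℝ} (hX : Supermartingale X H P)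
    (h0 : ∀ t ω, 0 ≤ X t ω) (a b : ℝ) (hab : a < b) (N : ℕ) :
    ∀ᵐ ω ∂P, ∃ n, ¬ Alt (fun s => -X s ω) a b 0 n N := by
  set Y : ℝ≥0 → Ω → ℝ := fun s ω => - X s ω with hY
  set U : ℕ → Ω → ℕ := fun k => upcrossingsBefore a b (fun j ω => Y (dy k j) ω) (N * 2 ^ k)
  have hsub : ∀ k, Submartingale (fun j ω => Y (dy k j) ω) (gridFil H k) P :=
    fun k => (grid_sub hX k).neg
  have hmeas : ∀ k, Measurable (U k) := fun k =>
    (hsub k).stronglyAdapted.measurable_upcrossingsBefore hab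
  have hbound : ∀ k, ∫⁻ ω, (U k ω : ℝ≥0∞) ∂P ≤ ENNReal.ofReal (|a| / (b - a)) := by
    intro k
    have h1 := (hsub k).mul_integral_upcrossingsBefore_le_integral_pos_part a b (N * 2 ^ k)
    have h2 : ∫ ω, (Y (dy k (N * 2 ^ k)) ω - a)⁺ ∂P ≤ |a| := by
      have : ∫ ω, (Y (dy k (N * 2 ^ k)) ω - a)⁺ ∂P ≤ ∫ ω, |a| ∂P := by
        refine integral_mono_of_nonneg (Eventually.of_forall fun ω => posPart_nonneg _)
          (integrable_const _) (Eventually.of_forall fun ω => ?_)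
        simp only [hY, posPart_def]
        refine sup_le ?_ (abs_nonneg _)
        have := h0 (dy k (N * 2 ^ k)) ω
        have := neg_abs_le a
        linarith
      simpa using this
    have h3 : ∫ ω, (U k ω : ℝ) ∂P ≤ |a| / (b - a) := by
      rw [le_div_iff₀ (sub_pos.2 hab), mul_comm]
      exact h1.trans h2
    have h4 : ∫⁻ ω, (U k ω : ℝ≥0∞) ∂P = ENNReal.ofReal (∫ ω, (U k ω : ℝ) ∂P) := by
      rw [ofReal_integral_eq_lintegral_ofReal]
      · simp
      · exact (hsub k).stronglyAdapted.integrable_upcrossingsBefore hab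
      · exact Eventually.of_forall fun ω => Nat.cast_nonneg _
    rw [h4]
    exact ENNReal.ofReal_le_ofReal h3
  have hm' : ∀ k, Measurable fun ω => (U k ω : ℝ≥0∞) := fun k =>
    (measurable_from_top (f := fun n : ℕ => (n : ℝ≥0∞))).comp (hmeas k)
  have hlim : ∫⁻ ω, liminf (fun k => (U k ω : ℝ≥0∞)) atTop ∂P ≠ ∞ := by
    refine ne_of_lt (lt_of_le_of_lt (lintegral_liminf_le hm') ?_)
    refine lt_of_le_of_lt (liminf_le_of_frequently_le' (Frequently.of_forall hbound)) ?_
    exact ENNReal.ofReal_lt_top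
  filter_upwards [ae_lt_top (Measurable.liminf hm') hlim] with ω hω
  by_contra! hcon
  refine absurd hω (not_lt.2 ?_)
  refine ENNReal.le_of_forall_nnreal_lt fun r _ => ?_
  obtain ⟨n, hn⟩ := exists_nat_ge r
  refine le_liminf_of_le (by isBoundedDefault) ?_
  filter_upwards [alt_upcrossings (X := Y) (ω := ω) hab (hcon n)] with k hk
  have := hk (N * 2 ^ k) (dy_nat k N).ge
  calc (r : ℝ≥0∞) ≤ (n : ℝ≥0∞) := by exact_mod_cast hn
    _ ≤ _ := by exact_mod_cast this

lemma max_ineq {Ω : Type*} {m : MeasurableSpace Ω} {P : Measure Ω} [IsProbabilityMeasure P]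
    {H : Filtration ℕ m} {X : ℕ → Ω → ℝ} (hX : Supermartingale X H P)
    (h0 : ∀ t ω, 0 ≤ X t ω) (c : ℝ) (n : ℕ) :
    ENNReal.ofReal c * P {ω | ∃ i < n, c < X i ω} +
      ∫⁻ ω in {ω | ∃ i < n, c < X i ω}ᶜ, ENNReal.ofReal (X n ω) ∂P
      ≤ ∫⁻ ω, ENNReal.ofReal (X 0 ω) ∂P := by
  have hXm : ∀ i, Measurable (X i) := fun i => ((hX.1 i).mono (H.le i)).measurable
  have hBH : ∀ n j, n ≤ j + 1 → MeasurableSet[H j] {ω | ∃ i < n, c < X i ω} := by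
    intro n j hj
    have : {ω | ∃ i < n, c < X i ω} = ⋃ i ∈ Finset.range n, {ω | c < X i ω} := by
      ext ω; simp
    rw [this]
    refine Finset.measurableSet_biUnion _ fun i hi => ?_
    refine H.mono (i := i) (by simp at hi; omega) _ ?_
    exact (hX.1 i).measurable measurableSet_Ioi
  induction n with
  | zero => simp
  | succ n ih =>
    refine le_trans ?_ ih
    set B := {ω | ∃ i < n, c < X i ω}
    set B' := {ω | ∃ i < n + 1, c < X i ω}
    have hBm : MeasurableSet B := H.le n _ (hBH n n (by omega))
    have hBm' : MeasurableSet B' := H.le n _ (hBH (n + 1) n le_rfl)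
    have hBB : B ⊆ B' := fun ω ⟨i, hi, h⟩ => ⟨i, by omega, h⟩
    have hd : Bᶜ = (B' \ B) ∪ B'ᶜ := by
      ext ω; by_cases h1 : ω ∈ B <;> by_cases h2 : ω ∈ B' <;> simp [h1, h2]; exact h2 (hBB h1)
    have hstep : ∫⁻ ω in B'ᶜ, ENNReal.ofReal (X (n + 1) ω) ∂P ≤
        ∫⁻ ω in B'ᶜ, ENNReal.ofReal (X n ω) ∂P := by
      rw [← ofReal_integral_eq_lintegral_ofReal (hX.2.2 _).integrableOn
          (Eventually.of_forall fun ω => h0 _ _),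
        ← ofReal_integral_eq_lintegral_ofReal (hX.2.2 _).integrableOn
          (Eventually.of_forall fun ω => h0 _ _)]
      exact ENNReal.ofReal_le_ofReal
        (hX.setIntegral_le (Nat.le_succ n) (hBH (n + 1) n le_rfl).compl)
    have hP : P B' = P B + P (B' \ B) := by
      rw [← measure_union disjoint_sdiff_right (hBm'.diff hBm), union_sdiff_cancel hBB]
    have hge : ENNReal.ofReal c * P (B' \ B) ≤ ∫⁻ ω in B' \ B, ENNReal.ofReal (X n ω) ∂P := by
      rw [← setLIntegral_const]
      refine setLIntegral_mono (hXm n).ennreal_ofReal ?_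
      rintro ω ⟨⟨i, hi, h⟩, h'⟩
      have : i = n := by
        by_contra hne
        exact h' ⟨i, by omega, h⟩
      subst this
      exact ENNReal.ofReal_le_ofReal h.le
    rw [hP, mul_add, add_assoc]
    gcongr
    rw [hd, lintegral_union hBm'.compl]
    · exact add_le_add hge hstep
    · exact disjoint_compl_right.mono_left sdiff_subset

lemma ae_bdd {Ω : Type*} {m : MeasurableSpace Ω} {P : Measure Ω} [IsProbabilityMeasure P]
    {H : Filtration ℝ≥0 m} {X : ℝ≥0 → Ω → ℝ} (hX : Supermartingale X H P)
    (h0 : ∀ t ω, 0 ≤ X t ω) (N : ℕ) :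
    ∀ᵐ ω ∂P, ∃ c : ℝ, ∀ q ∈ Dy, q ≤ N → X q ω ≤ c := by
  set I := ∫⁻ ω, ENNReal.ofReal (X 0 ω) ∂P with hI
  have hItop : I ≠ ∞ := (hX.2.2 0).lintegral_lt_top.ne
  set E : ℕ → ℕ → Set Ω := fun c k => {ω | ∃ i < N * 2 ^ k + 1, (c : ℝ) < X (dy k i) ω}
  have hE : ∀ c k : ℕ, (c : ℝ≥0∞) * P (E c k) ≤ I := by
    intro c k
    have := max_ineq (grid_sub hX k) (fun i ω => h0 _ ω) c (N * 2 ^ k + 1)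
    have hz : dy k 0 = 0 := by simp [dy]
    rw [hz] at this
    refine le_trans ?_ this
    refine le_trans ?_ le_self_add
    simp [E]
  have hmono : ∀ c, Monotone (E c) := by
    intro c
    refine monotone_nat_of_le_succ fun k => ?_
    rintro ω ⟨i, hi, h⟩
    refine ⟨i * 2 ^ 1, ?_, ?_⟩
    · have : N * 2 ^ (k + 1) = N * 2 ^ k * 2 := by ring
      omega
    · rw [← dy_add]; exact h
  have hU : ∀ c : ℕ, (c : ℝ≥0∞) * P (⋃ k, E c k) ≤ I := by
    intro c
    rw [(hmono c).measure_iUnion, ENNReal.mul_iSup]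
    exact iSup_le (hE c)
  have hnull : P (⋂ c, ⋃ k, E c k) = 0 := by
    by_contra hne
    have h1 : ∀ c : ℕ, (c : ℝ≥0∞) * P (⋂ c, ⋃ k, E c k) ≤ I := fun c =>
      le_trans (by gcongr; exact iInter_subset _ c) (hU c)
    obtain ⟨c, hc⟩ := ENNReal.exists_nat_mul_gt hne hItop
    exact absurd (h1 c) (not_le.2 hc)
  have : ∀ᵐ ω ∂P, ω ∉ ⋂ c, ⋃ k, E c k := measure_eq_zero_iff_ae_notMem.1 hnull
  filter_upwards [this] with ω hω
  simp only [mem_iInter, not_forall, mem_iUnion, not_exists] at hω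
  obtain ⟨c, hc⟩ := hω
  refine ⟨c, ?_⟩
  rintro q ⟨k, i, rfl⟩ hq
  by_contra! hlt
  refine hc k ⟨i, ?_, hlt⟩
  rw [← dy_nat k N, dy_le_iff] at hq
  omega

/-- Regularity along dyadics. -/
def Reg (f : ℝ≥0 → ℝ) : Prop :=
  (∀ t, ∃ c, Tendsto f (𝓝[>] t ⊓ 𝓟 Dy) (𝓝 c)) ∧
    ∀ t, 0 < t → ∃ c, Tendsto f (𝓝[<] t ⊓ 𝓟 Dy) (𝓝 c)

lemma ae_reg {Ω : Type*} {m : MeasurableSpace Ω} {P : Measure Ω} [IsProbabilityMeasure P]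
    {H : Filtration ℝ≥0 m} {X : ℝ≥0 → Ω → ℝ} (hX : Supermartingale X H P)
    (h0 : ∀ t ω, 0 ≤ X t ω) : ∀ᵐ ω ∂P, Reg (fun t => X t ω) := by
  have h1 : ∀ᵐ ω ∂P, ∀ a b : ℚ, ∀ N : ℕ, a < b → ∃ n, ¬ Alt (fun s => -X s ω) a b 0 n N := by
    rw [ae_all_iff]; intro a
    rw [ae_all_iff]; intro b
    rw [ae_all_iff]; intro N
    by_cases hab : a < b
    · filter_upwards [ae_no_alt hX h0 a b (by exact_mod_cast hab) N] with ω hω _ using hω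
    · exact Eventually.of_forall fun ω h => absurd h hab
  have h2 : ∀ᵐ ω ∂P, ∀ N : ℕ, ∃ c : ℝ, ∀ q ∈ Dy, q ≤ N → X q ω ≤ c := by
    rw [ae_all_iff]; exact ae_bdd hX h0
  filter_upwards [h1, h2] with ω hω1 hω2
  have gen : ∀ (l : Filter ℝ≥0) (t : ℝ≥0), l ≤ 𝓝 t → l ≤ 𝓟 Dy →
      (∀ a b : ℝ, (∃ᶠ n in l, -X n ω < a) → (∃ᶠ n in l, b < -X n ω) → ∀ n, ∀ s, t < s → 
        Alt (fun s => -X s ω) a b 0 n s) → ∃ c, Tendsto (fun t => X t ω) l (𝓝 c) := by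
    intro l t hlt hlD H
    obtain ⟨N, hN⟩ := exists_nat_gt t
    obtain ⟨C, hC⟩ := hω2 N
    have hev : ∀ᶠ s in l, X s ω ≤ C := by
      filter_upwards [hlt (Iio_mem_nhds hN), hlD (mem_principal_self _)] with s hs hsD
      exact hC s hsD (le_of_lt hs)
    obtain ⟨c, hc⟩ := tendsto_of_no_upcrossings (f := l) (u := fun t => - X t ω)
      (s := Set.range ((↑) : ℚ → ℝ)) Rat.denseRange_cast (by
        rintro _ ⟨a, rfl⟩ _ ⟨b, rfl⟩ hab ⟨ha, hb⟩
        obtain ⟨n, hn⟩ := hω1 a b N (by exact_mod_cast hab)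
        exact hn (H a b ha hb n N hN))
      ⟨0, by
        rw [eventually_map]
        exact Eventually.of_forall fun s => by simpa using h0 s ω⟩
      ⟨-C, by
        rw [eventually_map]
        filter_upwards [hev] with s hs using neg_le_neg hs⟩
    exact ⟨-c, by simpa using hc.neg⟩
  constructor
  · intro t
    refine gen _ t (inf_le_left.trans nhdsWithin_le_nhds) inf_le_right ?_
    intro a b ha hb n s hs
    obtain ⟨lo, _, hlo⟩ := alt_right ha hb s hs n
    exact hlo.lo_mono (zero_le)
  · intro t ht
    refine gen _ t (inf_le_left.trans nhdsWithin_le_nhds) inf_le_right ?_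
    intro a b ha hb n s hs
    obtain ⟨hi, hhi, H⟩ := alt_left ht ha hb n
    exact H.mono (hhi.trans hs).le

lemma reg_cadlag {f g : ℝ≥0 → ℝ} (hf : Reg f)
    (hg : ∀ t, Tendsto f (𝓝[>] t ⊓ 𝓟 Dy) (𝓝 (g t))) :
    (∀ t, ContinuousWithinAt g (Ici t) t) ∧
      ∀ t, 0 < t → ∃ c, Tendsto g (𝓝[<] t) (𝓝 c) := by
  constructor
  · intro t
    rw [ContinuousWithinAt, (closed_nhds_basis (g t)).tendsto_right_iff]
    rintro V ⟨hV, hVc⟩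
    have h1 := hg t hV
    rw [mem_map, mem_inf_principal] at h1
    obtain ⟨u, hu, hu'⟩ := mem_nhdsGT_iff_exists_Ioo_subset.1 h1
    filter_upwards [Ico_mem_nhdsGE hu] with s hs
    refine hVc.mem_of_tendsto (hg s) ?_
    rw [eventually_inf_principal]
    filter_upwards [Ioo_mem_nhdsGT hs.2] with x hx hxD
    exact hu' ⟨hs.1.trans_lt hx.1, hx.2⟩ hxD
  · intro t ht
    obtain ⟨c, hc⟩ := hf.2 t ht
    refine ⟨c, ?_⟩
    rw [(closed_nhds_basis c).tendsto_right_iff]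
    rintro V ⟨hV, hVc⟩
    have h1 := hc hV
    rw [mem_map, mem_inf_principal] at h1
    obtain ⟨u, hu, hu'⟩ := (mem_nhdsLT_iff_exists_Ioo_subset' ht).1 h1
    filter_upwards [Ioo_mem_nhdsLT hu] with s hs
    refine hVc.mem_of_tendsto (hg s) ?_
    rw [eventually_inf_principal]
    filter_upwards [Ioo_mem_nhdsGT hs.2] with x hx hxD
    exact hu' ⟨hs.1.trans hx.1, hx.2⟩ hxD

lemma ind_meas {α : Type*} {K : MeasurableSpace α} {N : Set α} (hN : MeasurableSet N) :
    Measurable (N.indicator (1 : α → ℝ≥0∞)) := measurable_one.indicator hN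

lemma exists_density {α : Type*} (K : MeasurableSpace α) {m0 : MeasurableSpace α} (hK : K ≤ m0)
    (Q R : Measure α) [IsFiniteMeasure Q] [IsFiniteMeasure R]
    (h : ∀ s, MeasurableSet[K] s → R s = 0 → Q s = 0) :
    ∃ p : α → ℝ≥0∞, Measurable[K] p ∧
      ∀ g : α → ℝ≥0∞, Measurable[K] g → ∫⁻ x, g x ∂Q = ∫⁻ x, g x * p x ∂(R) := by
  have hac : Q.trim hK ≪ R.trim hK := by
    refine Measure.AbsolutelyContinuous.mk fun s hs h0 => ?_
    rw [trim_measurableSet_eq hK hs] at h0 ⊢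
    exact h s hs h0
  have hpm : Measurable[K] ((Q.trim hK).rnDeriv (R.trim hK)) := Measure.measurable_rnDeriv _ _
  refine ⟨(Q.trim hK).rnDeriv (R.trim hK), hpm, fun g hg => ?_⟩
  rw [← lintegral_trim hK hg, ← lintegral_rnDeriv_mul hac hg.aemeasurable]
  refine (lintegral_trim hK (hpm.mul hg)).trans ?_
  exact lintegral_congr fun x => mul_comm _ _

/-- product sigma algebra `F ⊗ 𝓛`. -/
abbrev KK {Ω : Type*} (𝕃 : Type*) [MeasurableSpace 𝕃] (F : MeasurableSpace Ω) :
    MeasurableSpace (Ω × 𝕃) := F.prod inferInstance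

lemma KK_mono {Ω 𝕃 : Type*} [MeasurableSpace 𝕃] {F F' : MeasurableSpace Ω} (h : F ≤ F') :
    KK 𝕃 F ≤ KK 𝕃 F' := sup_le_sup (MeasurableSpace.comap_mono h) le_rfl

lemma comap_KK {Ω 𝕃 : Type*} [MeasurableSpace 𝕃] (F : MeasurableSpace Ω) (L : Ω → 𝕃) :
    F ⊔ MeasurableSpace.comap L inferInstance =
      MeasurableSpace.comap (fun ω => (ω, L ω)) (KK 𝕃 F) := by
  rw [KK, MeasurableSpace.prod, MeasurableSpace.comap_sup, MeasurableSpace.comap_comp,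
    MeasurableSpace.comap_comp]
  congr 1
  exact MeasurableSpace.comap_id.symm

lemma jacod_ac {Ω 𝕃 : Type*} (F : MeasurableSpace Ω) {m : MeasurableSpace Ω} [MeasurableSpace 𝕃]
    (P : Measure Ω) [IsProbabilityMeasure P] (hF : F ≤ m)
    (L : Ω → 𝕃) (hL : Measurable L) (κ : Ω → Measure 𝕃) (hκprob : ∀ ω, IsProbabilityMeasure (κ ω))
    (hκmeas : ∀ B : Set 𝕃, MeasurableSet B → Measurable[F] fun ω => κ ω B)
    (hκcond : ∀ B : Set 𝕃, MeasurableSet B → ∀ A : Set Ω, MeasurableSet[F] A →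
      P (A ∩ L ⁻¹' B) = ∫⁻ ω in A, κ ω B ∂P)
    (hjacod : ∀ᵐ ω ∂P, κ ω ≪ P.map L) (s : Set (Ω × 𝕃)) (hs : MeasurableSet[KK 𝕃 F] s)
    (h0 : (P.prod (P.map L)) s = 0) : (P.map (fun ω => (ω, L ω))) s = 0 := by
  have hLp : Measurable fun ω => (ω, L ω) := measurable_id.prodMk hL
  haveI := Measure.isProbabilityMeasure_map (μ := P) hL.aemeasurable
  haveI := Measure.isProbabilityMeasure_map (μ := P) hLp.aemeasurable
  let η : ProbabilityTheory.Kernel Ω 𝕃 :=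
    ⟨κ, Measure.measurable_of_measurable_coe _ fun B hB => (hκmeas B hB).mono hF le_rfl⟩
  haveI : ProbabilityTheory.IsMarkovKernel η := ⟨hκprob⟩
  have hle : KK 𝕃 F ≤ KK 𝕃 m := KK_mono hF
  have heq : (P.map (fun ω => (ω, L ω))) s = (P.compProd η) s := by
    refine ext_on_measurableSpace_of_generate_finite (KK 𝕃 m)
      (image2 (· ×ˢ ·) {s : Set Ω | MeasurableSet[F] s} {t : Set 𝕃 | MeasurableSet t}) ?_ hle
      (@generateFrom_prod _ _ F _).symm (@isPiSystem_prod _ _ F _) ?_ hs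
    · rintro _ ⟨A, hA, B, hB, rfl⟩
      have hA' : MeasurableSet A := hF _ hA
      have hB' : MeasurableSet B := hB
      rw [Measure.map_apply hLp (hA'.prod hB'), Measure.compProd_apply_prod hA' hB']
      exact hκcond B hB A hA
    · simp
  have hs' : MeasurableSet s := hle _ hs
  rw [heq, Measure.compProd_apply hs', lintegral_eq_zero_iff
    (ProbabilityTheory.Kernel.measurable_kernel_prodMk_left hs')]
  rw [Measure.measure_prod_null hs'] at h0
  filter_upwards [h0, hjacod] with ω h1 h2
  exact h2 h1

/-- The abstract data of densities: `p t` is the density of `(ω, L ω)` on `F_t ⊗ 𝓛`. -/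
structure Dens {Ω 𝕃 : Type*} {m : MeasurableSpace Ω} [MeasurableSpace 𝕃] (P : Measure Ω)
    (ℱ : Filtration ℝ≥0 m) (L : Ω → 𝕃) (p : ℝ≥0 → Ω × 𝕃 → ℝ≥0∞) : Prop where
  meas : ∀ t, Measurable[KK 𝕃 (ℱ t)] (p t)
  dens : ∀ t, ∀ g : Ω × 𝕃 → ℝ≥0∞, Measurable[KK 𝕃 (ℱ t)] g →
    ∫⁻ ω, g (ω, L ω) ∂P = ∫⁻ x, g x * p t x ∂(P.prod (P.map L))

section D

variable {Ω 𝕃 : Type*} {m : MeasurableSpace Ω} [MeasurableSpace 𝕃] {P : Measure Ω}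
  [IsProbabilityMeasure P] {ℱ : Filtration ℝ≥0 m} {L : Ω → 𝕃} {p : ℝ≥0 → Ω × 𝕃 → ℝ≥0∞}

lemma Dens.null (hp : Dens P ℱ L p) (t : ℝ≥0) (N : Set (Ω × 𝕃)) (hN : MeasurableSet[KK 𝕃 (ℱ t)] N)
    (h : ∀ᵐ x ∂(P.prod (P.map L)), x ∈ N → p t x = 0) : ∀ᵐ ω ∂P, (ω, L ω) ∉ N := by
  have h1 := hp.dens t (N.indicator 1) (ind_meas hN)
  have hz : ∫⁻ x, N.indicator 1 x * p t x ∂(P.prod (P.map L)) = 0 := by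
    rw [← lintegral_zero (μ := P.prod (P.map L))]
    refine lintegral_congr_ae ?_
    filter_upwards [h] with x hx
    by_cases hxN : x ∈ N
    · simp [hx hxN]
    · simp [hxN]
  rw [hz] at h1
  by_contra hcon
  have hset : ¬ ∀ᵐ ω ∂P, N.indicator (1 : Ω × 𝕃 → ℝ≥0∞) (ω, L ω) = 0 := by
    intro h2
    refine hcon ?_
    filter_upwards [h2] with ω hω hmem
    simp [hmem] at hω
  refine hset ?_
  by_cases hL : AEMeasurable L P
  · have hm : AEMeasurable (fun ω => N.indicator (1 : Ω × 𝕃 → ℝ≥0∞) (ω, L ω)) P :=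
      (((ind_meas hN).mono (KK_mono (ℱ.le t)) le_rfl :
        Measurable (N.indicator (1 : Ω × 𝕃 → ℝ≥0∞)))).comp_aemeasurable
        (aemeasurable_id.prodMk hL)
    exact (lintegral_eq_zero_iff' hm).1 h1
  · have h2 := hp.dens t (fun _ => 1) measurable_const
    rw [Measure.map_of_not_aemeasurable hL] at h2
    simp at h2

lemma Dens.ne_zero (hp : Dens P ℱ L p) (t : ℝ≥0) : ∀ᵐ ω ∂P, p t (ω, L ω) ≠ 0 :=
  hp.null t {x | p t x = 0} (hp.meas t (measurableSet_singleton 0))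
    (Eventually.of_forall fun _ hx => hx)

lemma Dens.lintegral (hp : Dens P ℱ L p) (t : ℝ≥0) :
    ∫⁻ x, p t x ∂(P.prod (P.map L)) = 1 := by
  have h := hp.dens t (fun _ => 1) measurable_const
  simpa using h.symm

lemma Dens.measurable (hp : Dens P ℱ L p) (t : ℝ≥0) : Measurable (p t) :=
  (hp.meas t).mono (KK_mono (ℱ.le t)) le_rfl

lemma Dens.ne_top' (hp : Dens P ℱ L p) (t : ℝ≥0) :
    ∀ᵐ x ∂(P.prod (P.map L)), p t x ≠ ∞ := by
  have := ae_lt_top (hp.measurable t) (by rw [hp.lintegral]; exact ENNReal.one_ne_top)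
  filter_upwards [this] with x hx using hx.ne

lemma Dens.ne_top (hp : Dens P ℱ L p) (t : ℝ≥0) : ∀ᵐ ω ∂P, p t (ω, L ω) ≠ ∞ :=
  hp.null t {x | p t x = ∞} (hp.meas t (measurableSet_singleton ∞)) (by
    filter_upwards [hp.ne_top' t] with x hx hx' using absurd hx' hx)

lemma Dens.ident (hp : Dens P ℱ L p) (t : ℝ≥0) (g : Ω × 𝕃 → ℝ≥0∞)
    (hg : Measurable[KK 𝕃 (ℱ t)] g) :
    ∫⁻ ω, g (ω, L ω) * (p t (ω, L ω))⁻¹ ∂P =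
      ∫⁻ x, {x | p t x ≠ 0}.indicator g x ∂(P.prod (P.map L)) := by
  have := hp.dens t (fun x => g x * (p t x)⁻¹) (hg.mul (hp.meas t).inv)
  rw [this]
  refine lintegral_congr_ae ?_
  filter_upwards [hp.ne_top' t] with x hx
  by_cases h0 : p t x = 0
  · simp [h0]
  · simp [h0, mul_assoc, ENNReal.inv_mul_cancel h0 hx]

lemma Dens.supp (hp : Dens P ℱ L p) {u v : ℝ≥0} (huv : u ≤ v) :
    ∀ᵐ x ∂(P.prod (P.map L)), p v x ≠ 0 → p u x ≠ 0 := by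
  set N := {x | p u x = 0} with hN
  have hNm : MeasurableSet[KK 𝕃 (ℱ u)] N := hp.meas u (measurableSet_singleton 0)
  have hNv : MeasurableSet[KK 𝕃 (ℱ v)] N := KK_mono (ℱ.mono huv) _ hNm
  have h1 := hp.dens u (N.indicator 1) (ind_meas hNm)
  have h2 := hp.dens v (N.indicator 1) (ind_meas hNv)
  have hz : ∫⁻ x, N.indicator 1 x * p u x ∂(P.prod (P.map L)) = 0 := by
    rw [← lintegral_zero (μ := P.prod (P.map L))]
    refine lintegral_congr fun x => ?_
    by_cases hxN : x ∈ N
    · have : p u x = 0 := hxN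
      simp [this]
    · simp [hxN]
  rw [← h1, h2, lintegral_eq_zero_iff] at hz
  · filter_upwards [hz] with x hx hv hu
    have : x ∈ N := hu
    simp [this] at hx
    exact hv hx
  · exact (measurable_one.indicator (KK_mono (ℱ.le v) _ hNv)).mul (hp.measurable v)

lemma super_set {M : ℝ≥0 → Ω → ℝ} (hM : Supermartingale M ℱ P) (h0 : ∀ t ω, 0 ≤ M t ω)
    {s t : ℝ≥0} (hst : s ≤ t) {A : Set Ω} (hA : MeasurableSet[ℱ s] A) :
    ∫⁻ ω in A, ENNReal.ofReal (M t ω) ∂P ≤ ∫⁻ ω in A, ENNReal.ofReal (M s ω) ∂P := by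
  rw [← ofReal_integral_eq_lintegral_ofReal (hM.2.2 _).integrableOn
      (Eventually.of_forall fun ω => h0 _ _),
    ← ofReal_integral_eq_lintegral_ofReal (hM.2.2 _).integrableOn
      (Eventually.of_forall fun ω => h0 _ _)]
  exact ENNReal.ofReal_le_ofReal (hM.setIntegral_le hst hA)

lemma Dens.key (hp : Dens P ℱ L p) {M : ℝ≥0 → Ω → ℝ} (hM : Supermartingale M ℱ P)
    (h0 : ∀ t ω, 0 ≤ M t ω) {u t v : ℝ≥0} (hut : u ≤ t) (htv : t ≤ v) {A : Set Ω}
    (hA : MeasurableSet[ℱ u ⊔ MeasurableSpace.comap L inferInstance] A) (hAm : MeasurableSet A) :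
    ∫⁻ ω in A, ENNReal.ofReal (M t ω) * (p v (ω, L ω))⁻¹ ∂P ≤
      ∫⁻ ω in A, ENNReal.ofReal (M u ω) * (p u (ω, L ω))⁻¹ ∂P := by
  rw [comap_KK] at hA
  obtain ⟨C, hC, rfl⟩ := hA
  have hmeasM : ∀ r w, r ≤ w → Measurable[KK 𝕃 (ℱ w)]
      (fun x : Ω × 𝕃 => ENNReal.ofReal (M r x.1)) := by
    intro r w hrw
    refine Measurable.ennreal_ofReal ?_
    exact ((hM.1 r).measurable.mono (ℱ.mono hrw) le_rfl).comp (@measurable_fst _ _ (ℱ w) _)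
  have conv : ∀ r w, r ≤ w → u ≤ w →
      ∫⁻ ω in (fun ω => (ω, L ω)) ⁻¹' C, ENNReal.ofReal (M r ω) * (p w (ω, L ω))⁻¹ ∂P =
      ∫⁻ x, {x | p w x ≠ 0}.indicator
        (C.indicator fun x : Ω × 𝕃 => ENNReal.ofReal (M r x.1)) x ∂(P.prod (P.map L)) := by
    intro r w hrw huw
    rw [← hp.ident w _ ((hmeasM r w hrw).indicator (KK_mono (ℱ.mono huw) _ hC)),
      ← lintegral_indicator hAm]
    refine lintegral_congr fun ω => ?_
    by_cases h : (ω, L ω) ∈ C <;> simp [h]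
  rw [conv t v htv (hut.trans htv), conv u u le_rfl le_rfl]
  set S := {x | p u x ≠ 0} with hS
  have hSm : MeasurableSet[KK 𝕃 (ℱ u)] S := (hp.meas u (measurableSet_singleton 0)).compl
  have hSC : MeasurableSet[KK 𝕃 (ℱ u)] (S ∩ C) := hSm.inter hC
  have hSC' : MeasurableSet (S ∩ C) := KK_mono (ℱ.le u) _ hSC
  have step1 : ∫⁻ x, {x | p v x ≠ 0}.indicator
        (C.indicator fun x : Ω × 𝕃 => ENNReal.ofReal (M t x.1)) x ∂(P.prod (P.map L)) ≤
      ∫⁻ x, (S ∩ C).indicator (fun x : Ω × 𝕃 => ENNReal.ofReal (M t x.1)) x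
        ∂(P.prod (P.map L)) := by
    refine lintegral_mono_ae ?_
    filter_upwards [hp.supp (hut.trans htv)] with x hx
    by_cases h1 : p v x = 0
    · simp [h1]
    · have hxS : x ∈ S := hx h1
      by_cases hxC : x ∈ C <;> simp [h1, hxS, hxC]
  refine step1.trans ?_
  rw [indicator_indicator]
  have hM' : ∀ r, Measurable ((S ∩ C).indicator (fun x : Ω × 𝕃 => ENNReal.ofReal (M r x.1))) :=
    fun r => ((hmeasM r r le_rfl).mono (KK_mono (ℱ.le r)) le_rfl).indicator hSC'
  rw [lintegral_prod_symm' _ (hM' t), lintegral_prod_symm' _ (hM' u)]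
  refine lintegral_mono fun ℓ => ?_
  have hsl : MeasurableSet[ℱ u] ((fun ω => (ω, ℓ)) ⁻¹' (S ∩ C)) :=
    (@measurable_prodMk_right _ _ (ℱ u) _ ℓ) hSC
  have e : ∀ r, ∫⁻ ω, (S ∩ C).indicator (fun x : Ω × 𝕃 => ENNReal.ofReal (M r x.1)) (ω, ℓ) ∂P =
      ∫⁻ ω in (fun ω => (ω, ℓ)) ⁻¹' (S ∩ C), ENNReal.ofReal (M r ω) ∂P := by
    intro r
    rw [← lintegral_indicator (ℱ.le u _ hsl)]
    rfl
  simp only [e]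
  exact super_set hM h0 hut hsl

lemma limsup_meas {Ω : Type*} {G : MeasurableSpace Ω} (t s : ℝ≥0) (hts : t < s)
    (F : ℝ≥0 → Ω → ℝ≥0∞) (hF : ∀ r, r < s → Measurable[G] (F r)) :
    Measurable[G] fun ω => limsup (fun n => F (qs t n) ω) atTop := by
  obtain ⟨k, hk⟩ := eventually_atTop.1 ((qs_tendsto t).eventually_lt_const hts)
  have : (fun ω => limsup (fun n => F (qs t n) ω) atTop) =
      fun ω => limsup (fun n => F (qs t (n + k)) ω) atTop := by
    ext ω
    exact (limsup_nat_add (fun n => F (qs t n) ω) k).symm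
  rw [this]
  exact Measurable.limsup fun n => hF _ (hk _ (by omega))

lemma liminf_meas {Ω : Type*} {G : MeasurableSpace Ω} (t s : ℝ≥0) (hts : t < s)
    (F : ℝ≥0 → Ω → ℝ≥0∞) (hF : ∀ r, r < s → Measurable[G] (F r)) :
    Measurable[G] fun ω => liminf (fun n => F (qs t n) ω) atTop := by
  obtain ⟨k, hk⟩ := eventually_atTop.1 ((qs_tendsto t).eventually_lt_const hts)
  have : (fun ω => liminf (fun n => F (qs t n) ω) atTop) =
      fun ω => liminf (fun n => F (qs t (n + k)) ω) atTop := by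
    ext ω
    exact (liminf_nat_add (fun n => F (qs t n) ω) k).symm
  rw [this]
  exact Measurable.liminf fun n => hF _ (hk _ (by omega))

lemma Dens.liminf_fin (hp : Dens P ℱ L p) (t : ℝ≥0) :
    ∀ᵐ ω ∂P, liminf (fun n => p (qs t n) (ω, L ω)) atTop ≠ ∞ := by
  have hm : Measurable[KK 𝕃 (ℱ (t + 1))] fun x => liminf (fun n => p (qs t n) x) atTop :=
    liminf_meas t (t + 1) (by simp) p fun r hr =>
      (hp.meas r).mono (KK_mono (ℱ.mono hr.le)) le_rfl
  refine hp.null (t + 1) {x | liminf (fun n => p (qs t n) x) atTop = ∞}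
    (hm (measurableSet_singleton ∞)) ?_
  have hfin : ∫⁻ x, liminf (fun n => p (qs t n) x) atTop ∂(P.prod (P.map L)) ≠ ∞ := by
    refine ne_of_lt (lt_of_le_of_lt (lintegral_liminf_le fun n => hp.measurable _) ?_)
    simp [hp.lintegral]
  filter_upwards [ae_lt_top (hm.mono (KK_mono (ℱ.le _)) le_rfl) hfin] with x hx hx'
  exact absurd hx' hx.ne

end D

section D2

variable {Ω 𝕃 : Type*} {m : MeasurableSpace Ω} [MeasurableSpace 𝕃] {P : Measure Ω}
  [IsProbabilityMeasure P] {ℱ : Filtration ℝ≥0 m} {L : Ω → 𝕃} {p : ℝ≥0 → Ω × 𝕃 → ℝ≥0∞}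

lemma Dens.bound (hp : Dens P ℱ L p) (hL : Measurable L) {M : ℝ≥0 → Ω → ℝ}
    (hM : Supermartingale M ℱ P) {t v : ℝ≥0} (htv : t ≤ v) :
    ∫⁻ ω, ENNReal.ofReal (M t ω) * (p v (ω, L ω))⁻¹ ∂P ≤ ∫⁻ ω, ENNReal.ofReal (M t ω) ∂P := by
  have := Measure.isProbabilityMeasure_map (μ := P) hL.aemeasurable
  have hm : Measurable[KK 𝕃 (ℱ v)] (fun x : Ω × 𝕃 => ENNReal.ofReal (M t x.1)) := by
    refine Measurable.ennreal_ofReal ?_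
    exact ((hM.1 t).measurable.mono (ℱ.mono htv) le_rfl).comp (@measurable_fst _ _ (ℱ v) _)
  rw [hp.ident v (fun x => ENNReal.ofReal (M t x.1)) hm]
  refine (lintegral_mono (indicator_le_self' fun _ _ => zero_le)).trans ?_
  rw [lintegral_prod _ (hm.mono (KK_mono (ℱ.le v)) le_rfl).aemeasurable]
  simp

/-- The raw inverse density process. -/
def XX (L : Ω → 𝕃) (p : ℝ≥0 → Ω × 𝕃 → ℝ≥0∞) (t : ℝ≥0) (ω : Ω) : ℝ := ((p t (ω, L ω))⁻¹).toReal

lemma XX_nonneg (t : ℝ≥0) (ω : Ω) : 0 ≤ XX L p t ω := ENNReal.toReal_nonneg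

lemma Dens.ofReal_XX (hp : Dens P ℱ L p) (t : ℝ≥0) :
    ∀ᵐ ω ∂P, ENNReal.ofReal (XX L p t ω) = (p t (ω, L ω))⁻¹ := by
  filter_upwards [hp.ne_zero t] with ω hω
  exact ENNReal.ofReal_toReal (ENNReal.inv_ne_top.2 hω)

/-- The initially enlarged filtration. -/
def G0 (ℱ : Filtration ℝ≥0 m) (L : Ω → 𝕃) (hL : Measurable L) : Filtration ℝ≥0 m where
  seq t := ℱ t ⊔ MeasurableSpace.comap L inferInstance
  mono' _ _ hst := sup_le_sup (ℱ.mono hst) le_rfl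
  le' t := sup_le (ℱ.le t) hL.comap_le

lemma Dens.meas_XX (hp : Dens P ℱ L p) (hL : Measurable L) (t : ℝ≥0) :
    Measurable[G0 ℱ L hL t] (XX L p t) := by
  have h1 : Measurable[G0 ℱ L hL t, KK 𝕃 (ℱ t)] fun ω => (ω, L ω) := by
    rw [measurable_iff_comap_le]
    exact (comap_KK (ℱ t) L).ge
  exact ((hp.meas t).inv.comp h1).ennreal_toReal

lemma Dens.meas_XX' (hp : Dens P ℱ L p) (hL : Measurable L) (t : ℝ≥0) :
    Measurable (XX L p t) := (hp.meas_XX hL t).mono ((G0 ℱ L hL).le t) le_rfl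

lemma Dens.key2 (hp : Dens P ℱ L p) (hL : Measurable L) {M : ℝ≥0 → Ω → ℝ}
    (hM : Supermartingale M ℱ P)
    (h0 : ∀ t ω, 0 ≤ M t ω) {u t v : ℝ≥0} (hut : u ≤ t) (htv : t ≤ v) {A : Set Ω}
    (hA : MeasurableSet[G0 ℱ L hL u] A) :
    ∫⁻ ω in A, ENNReal.ofReal (XX L p v ω * M t ω) ∂P ≤
      ∫⁻ ω in A, ENNReal.ofReal (XX L p u ω * M u ω) ∂P := by
  have e : ∀ r w, ∫⁻ ω in A, ENNReal.ofReal (XX L p w ω * M r ω) ∂P =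
      ∫⁻ ω in A, ENNReal.ofReal (M r ω) * (p w (ω, L ω))⁻¹ ∂P := by
    intro r w
    refine lintegral_congr_ae (ae_restrict_of_ae ?_)
    filter_upwards [hp.ofReal_XX w] with ω hω
    rw [ENNReal.ofReal_mul (XX_nonneg w ω), hω, mul_comm]
  rw [e, e]
  exact hp.key hM h0 hut htv hA ((G0 ℱ L hL).le u _ hA)

lemma Dens.bound2 (hp : Dens P ℱ L p) (hL : Measurable L) {M : ℝ≥0 → Ω → ℝ}
    (hM : Supermartingale M ℱ P) {t v : ℝ≥0} (htv : t ≤ v) :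
    ∫⁻ ω, ENNReal.ofReal (XX L p v ω * M t ω) ∂P ≤ ∫⁻ ω, ENNReal.ofReal (M t ω) ∂P := by
  refine le_trans (le_of_eq ?_) (hp.bound hL hM htv)
  refine lintegral_congr_ae ?_
  filter_upwards [hp.ofReal_XX v] with ω hω
  rw [ENNReal.ofReal_mul (XX_nonneg v ω), hω, mul_comm]

lemma integrable_of_bound {f : Ω → ℝ} (hf : Measurable f) (h0 : ∀ ω, 0 ≤ f ω)
    (h : ∫⁻ ω, ENNReal.ofReal (f ω) ∂P ≠ ∞) : Integrable f P := by
  refine ⟨hf.aestronglyMeasurable, ?_⟩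
  rw [hasFiniteIntegral_iff_ofReal (Eventually.of_forall h0)]
  exact h.lt_top

lemma Dens.super (hp : Dens P ℱ L p) (hL : Measurable L) :
    Supermartingale (XX L p) (G0 ℱ L hL) P := by
  have h1 : Supermartingale (fun (_ : ℝ≥0) (_ : Ω) => (1 : ℝ)) ℱ P :=
    (martingale_const ℱ P (1 : ℝ)).supermartingale
  have hInt : ∀ t, Integrable (XX L p t) P := by
    intro t
    refine integrable_of_bound (hp.meas_XX' hL t) (XX_nonneg t) (ne_of_lt ?_)
    have := hp.bound2 hL h1 (le_refl t)
    simp only [mul_one] at this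
    refine this.trans_lt ?_
    simp
  have hsub : Submartingale (-XX L p) (G0 ℱ L hL) P := by
    refine submartingale_of_setIntegral_le ?_ (fun t => (hInt t).neg) ?_
    · intro t
      exact (hp.meas_XX hL t).neg.stronglyMeasurable
    · intro s t hst A hA
      simp only [Pi.neg_apply, integral_neg, neg_le_neg_iff]
      have := hp.key2 hL h1 (fun _ _ => zero_le_one) hst le_rfl hA
      simp only [mul_one] at this
      rw [← ofReal_integral_eq_lintegral_ofReal (hInt _).integrableOn
          (Eventually.of_forall fun ω => XX_nonneg _ _),
        ← ofReal_integral_eq_lintegral_ofReal (hInt _).integrableOn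
          (Eventually.of_forall fun ω => XX_nonneg _ _)] at this
      exact (ENNReal.ofReal_le_ofReal_iff (integral_nonneg fun ω => XX_nonneg _ _)).1 this
  simpa using hsub.neg

lemma Dens.trunc (hp : Dens P ℱ L p) (hL : Measurable L) {M : ℝ≥0 → Ω → ℝ}
    (hM : Supermartingale M ℱ P)
    (h0 : ∀ t ω, 0 ≤ M t ω) {u t v : ℝ≥0} (hut : u ≤ t) (htv : t ≤ v) {A : Set Ω}
    (hA : MeasurableSet[G0 ℱ L hL u] A) (k : ℝ≥0∞) :
    ∫⁻ ω in A, min (ENNReal.ofReal (XX L p v ω * M t ω)) k ∂P ≤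
      ∫⁻ ω in A, min (ENNReal.ofReal (XX L p u ω * M u ω)) k ∂P := by
  set D := {ω | ENNReal.ofReal (XX L p u ω * M u ω) ≤ k} with hD
  have hMu : Measurable[G0 ℱ L hL u] (M u) := (hM.1 u).measurable.mono le_sup_left le_rfl
  have hf : Measurable[G0 ℱ L hL u] fun ω => ENNReal.ofReal (XX L p u ω * M u ω) :=
    ((hp.meas_XX hL u).mul hMu).ennreal_ofReal
  have hDm : MeasurableSet[G0 ℱ L hL u] D := hf measurableSet_Iic
  have hle := (G0 ℱ L hL).le u
  rw [← lintegral_inter_add_sdiff _ A (hle _ hDm), ← lintegral_inter_add_sdiff _ A (hle _ hDm)]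
  refine add_le_add ?_ ?_
  · have e : ∫⁻ ω in A ∩ D, min (ENNReal.ofReal (XX L p u ω * M u ω)) k ∂P =
        ∫⁻ ω in A ∩ D, ENNReal.ofReal (XX L p u ω * M u ω) ∂P := by
      refine setLIntegral_congr_fun (hle _ (hA.inter hDm)) fun ω hω => ?_
      exact min_eq_left hω.2
    rw [e]
    exact (lintegral_mono fun ω => min_le_left _ _).trans (hp.key2 hL hM h0 hut htv (hA.inter hDm))
  · have e : ∫⁻ ω in A \ D, min (ENNReal.ofReal (XX L p u ω * M u ω)) k ∂P =
        ∫⁻ ω in A \ D, k ∂P := by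
      refine setLIntegral_congr_fun (hle _ (hA.diff hDm)) fun ω hω => ?_
      exact min_eq_right (not_le.1 hω.2).le
    rw [e]
    exact lintegral_mono fun ω => min_le_right _ _

/-- The density process. -/
def ZZ (L : Ω → 𝕃) (p : ℝ≥0 → Ω × 𝕃 → ℝ≥0∞) (t : ℝ≥0) (ω : Ω) : ℝ :=
  (limsup (fun n => ENNReal.ofReal (XX L p (qs t n) ω)) atTop).toReal

lemma ZZ_nonneg (t : ℝ≥0) (ω : Ω) : 0 ≤ ZZ L p t ω := ENNReal.toReal_nonneg

lemma ZZ_lim {ω : Ω} (h : Reg fun t => XX L p t ω) (t : ℝ≥0) :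
    Tendsto (fun t => XX L p t ω) (𝓝[>] t ⊓ 𝓟 Dy) (𝓝 (ZZ L p t ω)) := by
  obtain ⟨c, hc⟩ := h.1 t
  have hc0 : 0 ≤ c := ge_of_tendsto' hc fun s => XX_nonneg s ω
  have h1 : Tendsto (fun n => ENNReal.ofReal (XX L p (qs t n) ω)) atTop (𝓝 (ENNReal.ofReal c)) :=
    (ENNReal.continuous_ofReal.tendsto c).comp (hc.comp (qs_tendsto' t))
  have : ZZ L p t ω = c := by
    rw [ZZ, h1.limsup_eq, ENNReal.toReal_ofReal hc0]
  rw [this]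
  exact hc

lemma Dens.ZZ_meas (hp : Dens P ℱ L p) (hL : Measurable L) {t s : ℝ≥0} (hts : t < s) :
    Measurable[G0 ℱ L hL s] (ZZ L p t) := by
  refine Measurable.ennreal_toReal ?_
  refine limsup_meas t s hts (fun r ω => ENNReal.ofReal (XX L p r ω)) fun r hr => ?_
  exact ((hp.meas_XX hL r).mono ((G0 ℱ L hL).mono hr.le) le_rfl).ennreal_ofReal

lemma Dens.ZZ_pos (hp : Dens P ℱ L p) (hL : Measurable L) (t : ℝ≥0) :
    ∀ᵐ ω ∂P, 0 < ZZ L p t ω := by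
  have hall : ∀ᵐ ω ∂P, ∀ n, ENNReal.ofReal (XX L p (qs t n) ω) = (p (qs t n) (ω, L ω))⁻¹ :=
    ae_all_iff.2 fun n => hp.ofReal_XX _
  filter_upwards [ae_reg (hp.super hL) XX_nonneg, hp.liminf_fin t, hall] with ω h1 h2 h3
  refine lt_of_le_of_ne (ZZ_nonneg t ω) fun h0 => h2 ?_
  have h4 := ((ENNReal.continuous_ofReal.tendsto _).comp
    ((ZZ_lim h1 t).comp (qs_tendsto' t)))
  rw [← h0, ENNReal.ofReal_zero] at h4
  have h5 : Tendsto (fun n => (p (qs t n) (ω, L ω))⁻¹) atTop (𝓝 0) := by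
    refine h4.congr fun n => h3 n
  have h6 := ENNReal.tendsto_inv_iff.2 h5
  simp only [inv_inv, ENNReal.inv_zero] at h6
  exact h6.liminf_eq

lemma M_right (hright : ∀ t : ℝ≥0, ℱ t = ⨅ (s : ℝ≥0) (_ : t < s), ℱ s)
    {M : ℝ≥0 → Ω → ℝ} (hM : Supermartingale M ℱ P) (h0 : ∀ t ω, 0 ≤ M t ω) (s : ℝ≥0) :
    ∀ᵐ ω ∂P, ∃ c, c ≤ M s ω ∧ Tendsto (fun n => M (qs s n) ω) atTop (𝓝 c) := by
  set W : Ω → ℝ≥0∞ := fun ω => liminf (fun n => ENNReal.ofReal (M (qs s n) ω)) atTop with hW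
  have hWm : Measurable[ℱ s] W := by
    intro B hB
    rw [hright s]
    simp only [MeasurableSpace.measurableSet_iInf]
    intro r hr
    have : Measurable[ℱ r] W :=
      liminf_meas s r hr (fun r ω => ENNReal.ofReal (M r ω)) fun r' hr' =>
        ((hM.1 r').measurable.mono (ℱ.mono hr'.le) le_rfl).ennreal_ofReal
    exact this hB
  have hMm : ∀ r, Measurable (M r) := fun r => (hM.1 r).measurable.mono (ℱ.le r) le_rfl
  have hle : W ≤ᵐ[P] fun ω => ENNReal.ofReal (M s ω) := by
    refine ae_le_of_ae_le_trim (hm := ℱ.le s) ?_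
    refine ae_le_of_forall_setLIntegral_le_of_sigmaFinite hWm fun B hB _ => ?_
    rw [restrict_trim (ℱ.le s) P hB, lintegral_trim (ℱ.le s) hWm,
      lintegral_trim (ℱ.le s) (hM.1 s).measurable.ennreal_ofReal]
    refine (lintegral_liminf_le fun n => (hMm _).ennreal_ofReal).trans ?_
    exact liminf_le_of_frequently_le' (Frequently.of_forall fun n =>
      super_set hM h0 (lt_qs s n).le hB)
  filter_upwards [hle, ae_reg hM h0] with ω h1 h2
  obtain ⟨c, hc⟩ := h2.1 s
  have hc' := hc.comp (qs_tendsto' s)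
  refine ⟨c, ?_, hc'⟩
  have h3 : W ω = ENNReal.ofReal c :=
    ((ENNReal.continuous_ofReal.tendsto c).comp hc').liminf_eq
  rw [h3] at h1
  exact (ENNReal.ofReal_le_ofReal_iff (h0 s ω)).1 h1

lemma lintegral_le_of_trunc {μ : Measure Ω} {f : Ω → ℝ≥0∞} (hf : Measurable f) {C : ℝ≥0∞}
    (h : ∀ k : ℕ, ∫⁻ ω, min (f ω) k ∂μ ≤ C) : ∫⁻ ω, f ω ∂μ ≤ C := by
  have e : ∀ ω, f ω = ⨆ k : ℕ, min (f ω) (k : ℝ≥0∞) := by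
    intro ω
    have := inf_iSup_eq (f ω) (fun k : ℕ => (k : ℝ≥0∞))
    rw [ENNReal.iSup_natCast, inf_top_eq] at this
    exact this
  have : ∫⁻ ω, f ω ∂μ = ⨆ k : ℕ, ∫⁻ ω, min (f ω) (k : ℝ≥0∞) ∂μ := by
    rw [← lintegral_iSup (fun k => hf.min measurable_const)
      (fun i j hij ω => min_le_min_left _ (by exact_mod_cast hij))]
    exact lintegral_congr e
  rw [this]
  exact iSup_le h

lemma Dens.final (hp : Dens P ℱ L p) (hL : Measurable L)
    (hright : ∀ t : ℝ≥0, ℱ t = ⨅ (s : ℝ≥0) (_ : t < s), ℱ s)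
    {M : ℝ≥0 → Ω → ℝ} (hM : Supermartingale M ℱ P) (h0 : ∀ t ω, 0 ≤ M t ω)
    {s t : ℝ≥0} (hst : s < t) {A : Set Ω} (hA : ∀ r, s < r → MeasurableSet[G0 ℱ L hL r] A) :
    ∫⁻ ω in A, ENNReal.ofReal (ZZ L p t ω * M t ω) ∂P ≤
      ∫⁻ ω in A, ENNReal.ofReal (ZZ L p s ω * M s ω) ∂P := by
  have hMm : ∀ r, Measurable (M r) := fun r => (hM.1 r).measurable.mono (ℱ.le r) le_rfl
  have hXm := hp.meas_XX' hL
  have hZm : ∀ r, Measurable (ZZ L p r) := fun r =>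
    (hp.ZZ_meas hL (lt_add_one r)).mono ((G0 ℱ L hL).le _) le_rfl
  have hreg := ae_reg (hp.super hL) XX_nonneg
  refine lintegral_le_of_trunc ((hZm t).mul (hMm t)).ennreal_ofReal fun k => ?_
  have hkfin : ∫⁻ _ in A, (k : ℝ≥0∞) ∂P ≠ ∞ := by
    rw [setLIntegral_const]
    exact ENNReal.mul_ne_top (ENNReal.natCast_ne_top k) (measure_ne_top _ _)
  have hcont : Continuous fun x : ℝ => min (ENNReal.ofReal x) (k : ℝ≥0∞) :=
    ENNReal.continuous_ofReal.min continuous_const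
  have lim1 : Tendsto (fun n => ∫⁻ ω in A,
      min (ENNReal.ofReal (XX L p (qs t n) ω * M t ω)) k ∂P) atTop
      (𝓝 (∫⁻ ω in A, min (ENNReal.ofReal (ZZ L p t ω * M t ω)) k ∂P)) := by
    refine tendsto_lintegral_of_dominated_convergence (fun _ => (k : ℝ≥0∞))
      (fun n => (((hXm _).mul (hMm t)).ennreal_ofReal).min measurable_const)
      (fun n => Eventually.of_forall fun ω => min_le_right _ _) hkfin (ae_restrict_of_ae ?_)
    filter_upwards [hreg] with ω hω
    exact (hcont.tendsto _).comp
      (((ZZ_lim hω t).comp (qs_tendsto' t)).mul tendsto_const_nhds)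
  have hMr := M_right hright hM h0 s
  set c : Ω → ℝ := fun ω => limUnder atTop (fun n => M (qs s n) ω) with hc
  have hc1 : ∀ᵐ ω ∂P, c ω ≤ M s ω ∧ Tendsto (fun n => M (qs s n) ω) atTop (𝓝 (c ω)) := by
    filter_upwards [hMr] with ω hω
    obtain ⟨d, hd1, hd2⟩ := hω
    have : c ω = d := hd2.limUnder_eq
    rw [this]
    exact ⟨hd1, hd2⟩
  have lim2 : Tendsto (fun n => ∫⁻ ω in A,
      min (ENNReal.ofReal (XX L p (qs s n) ω * M (qs s n) ω)) k ∂P) atTop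
      (𝓝 (∫⁻ ω in A, min (ENNReal.ofReal (ZZ L p s ω * c ω)) k ∂P)) := by
    refine tendsto_lintegral_of_dominated_convergence (fun _ => (k : ℝ≥0∞))
      (fun n => (((hXm _).mul (hMm _)).ennreal_ofReal).min measurable_const)
      (fun n => Eventually.of_forall fun ω => min_le_right _ _) hkfin (ae_restrict_of_ae ?_)
    filter_upwards [hreg, hc1] with ω hω hω2
    exact (hcont.tendsto _).comp
      (((ZZ_lim hω s).comp (qs_tendsto' s)).mul hω2.2)
  have step : ∫⁻ ω in A, min (ENNReal.ofReal (ZZ L p t ω * M t ω)) k ∂P ≤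
      ∫⁻ ω in A, min (ENNReal.ofReal (ZZ L p s ω * c ω)) k ∂P := by
    refine ge_of_tendsto lim2 ?_
    filter_upwards [(qs_tendsto s).eventually_lt_const hst] with j hj
    refine le_of_tendsto' lim1 fun n => ?_
    exact hp.trunc hL hM h0 hj.le (lt_qs t n).le (hA _ (lt_qs s j)) k
  refine step.trans (lintegral_mono_ae (ae_restrict_of_ae ?_))
  filter_upwards [hc1] with ω hω
  refine (min_le_left _ _).trans (ENNReal.ofReal_le_ofReal ?_)
  exact mul_le_mul_of_nonneg_left hω.1 (ZZ_nonneg s ω)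

lemma Dens.fin (hp : Dens P ℱ L p) (hL : Measurable L)
    {M : ℝ≥0 → Ω → ℝ} (hM : Supermartingale M ℱ P) (h0 : ∀ t ω, 0 ≤ M t ω) (t : ℝ≥0) :
    Integrable (fun ω => ZZ L p t ω * M t ω) P := by
  have hMm : ∀ r, Measurable (M r) := fun r => (hM.1 r).measurable.mono (ℱ.le r) le_rfl
  have hZm : Measurable (ZZ L p t) :=
    (hp.ZZ_meas hL (lt_add_one t)).mono ((G0 ℱ L hL).le _) le_rfl
  refine integrable_of_bound (hZm.mul (hMm t)) (fun ω => mul_nonneg (ZZ_nonneg t ω) (h0 t ω)) ?_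
  refine ne_of_lt (lt_of_le_of_lt ?_ (hM.2.2 t).lintegral_lt_top)
  have e : ∫⁻ ω, ENNReal.ofReal (ZZ L p t ω * M t ω) ∂P =
      ∫⁻ ω, liminf (fun n => ENNReal.ofReal (XX L p (qs t n) ω * M t ω)) atTop ∂P := by
    refine lintegral_congr_ae ?_
    filter_upwards [ae_reg (hp.super hL) XX_nonneg] with ω hω
    exact ((ENNReal.continuous_ofReal.tendsto _).comp
      (((ZZ_lim hω t).comp (qs_tendsto' t)).mul tendsto_const_nhds)).liminf_eq.symm
  rw [e]
  refine (lintegral_liminf_le fun n =>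
    ((hp.meas_XX' hL _).mul (hMm t)).ennreal_ofReal).trans ?_
  exact liminf_le_of_frequently_le' (Frequently.of_forall fun n =>
    hp.bound2 hL hM (lt_qs t n).le)

end D2

end Helpers

/-- (Jacod's criterion yields a universal supermartingale density.) Let
`G⁰_t = F_t ∨ σ(L)` be the initial enlargement of a right-continuous filtration `(F_t)` by a
random variable `L` with values in a standard Borel space, and let `G_t = ⋂_{s>t} G⁰_s`.
If the regular conditional distributions satisfy `P_t(ω, ·) ≪ P_L` a.s. for every `t`
(Jacod's criterion), then there exists a universal supermartingale density for `(G_t)`: an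
adapted, almost surely càdlàg process `Z` with `P(Z_t > 0) = 1` for all `t`, such that `ZM`
is a `(G_t)`-supermartingale for every nonnegative `(F_t)`-supermartingale `M`. -/
theorem statement17 {Ω 𝕃 : Type*} {m : MeasurableSpace Ω}
    [MeasurableSpace 𝕃] [StandardBorelSpace 𝕃]
    (P : Measure Ω) [IsProbabilityMeasure P]
    (ℱ : Filtration ℝ≥0 m)
    (hright : ∀ t : ℝ≥0, ℱ t = ⨅ (s : ℝ≥0) (_ : t < s), ℱ s)
    (L : Ω → 𝕃) (hL : Measurable L)
    (𝒢 : ℝ≥0 → MeasurableSpace Ω)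
    (h𝒢 : ∀ t : ℝ≥0,
      𝒢 t = ⨅ (s : ℝ≥0) (_ : t < s), (ℱ s ⊔ MeasurableSpace.comap L inferInstance))
    (κ : ℝ≥0 → Ω → Measure 𝕃)
    (hκprob : ∀ t ω, IsProbabilityMeasure (κ t ω))
    (hκmeas : ∀ t : ℝ≥0, ∀ B : Set 𝕃, MeasurableSet B → Measurable[ℱ t] fun ω => κ t ω B)
    (hκcond : ∀ t : ℝ≥0, ∀ B : Set 𝕃, MeasurableSet B → ∀ A : Set Ω, MeasurableSet[ℱ t] A →
      P (A ∩ L ⁻¹' B) = ∫⁻ ω in A, κ t ω B ∂P)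
    (hjacod : ∀ t : ℝ≥0, ∀ᵐ ω ∂P, κ t ω ≪ P.map L) :
    ∃ Z : ℝ≥0 → Ω → ℝ,
      (∀ t, Measurable[𝒢 t] (Z t)) ∧
      (∀ᵐ ω ∂P, (∀ t, ContinuousWithinAt (fun s => Z s ω) (Ici t) t) ∧
        ∀ t : ℝ≥0, 0 < t → ∃ c : ℝ, Tendsto (fun s => Z s ω) (𝓝[<] t) (𝓝 c)) ∧
      (∀ t, P {ω | 0 < Z t ω} = 1) ∧
      ∀ M : ℝ≥0 → Ω → ℝ, Supermartingale M ℱ P → (∀ t ω, 0 ≤ M t ω) →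
        (∀ t, Integrable (fun ω => Z t ω * M t ω) P) ∧
        ∀ s t : ℝ≥0, s ≤ t → ∀ A : Set Ω, MeasurableSet[𝒢 s] A →
          ∫ ω in A, Z t ω * M t ω ∂P ≤ ∫ ω in A, Z s ω * M s ω ∂P := by
  have hLp : Measurable fun ω => (ω, L ω) := measurable_id.prodMk hL
  have := Measure.isProbabilityMeasure_map (μ := P) hL.aemeasurable
  have := Measure.isProbabilityMeasure_map (μ := P) hLp.aemeasurable
  have hex : ∀ t, ∃ p : Ω × 𝕃 → ℝ≥0∞, Measurable[KK 𝕃 (ℱ t)] p ∧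
      ∀ g : Ω × 𝕃 → ℝ≥0∞, Measurable[KK 𝕃 (ℱ t)] g →
        ∫⁻ x, g x ∂(P.map fun ω => (ω, L ω)) = ∫⁻ x, g x * p x ∂(P.prod (P.map L)) := fun t =>
    exists_density (KK 𝕃 (ℱ t)) (KK_mono (ℱ.le t)) _ _
      (jacod_ac (ℱ t) P (ℱ.le t) L hL (κ t) (hκprob t) (hκmeas t) (hκcond t) (hjacod t))
  choose p hpm hpd using hex
  have hp : Dens P ℱ L p := ⟨hpm, fun t g hg => by
    rw [← hpd t g hg, lintegral_map (hg.mono (KK_mono (ℱ.le t)) le_rfl) hLp]⟩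
  have hreg := ae_reg (hp.super hL) XX_nonneg
  refine ⟨ZZ L p, ?_, ?_, ?_, ?_⟩
  · intro t B hB
    rw [h𝒢 t]
    simp only [MeasurableSpace.measurableSet_iInf]
    intro s hs
    exact hp.ZZ_meas hL hs hB
  · filter_upwards [hreg] with ω hω
    exact reg_cadlag hω (ZZ_lim hω)
  · intro t
    rw [← measure_univ (μ := P)]
    exact measure_congr (eventuallyEq_univ.2 (hp.ZZ_pos hL t))
  · intro M hM h0
    refine ⟨hp.fin hL hM h0, ?_⟩
    intro s t hst A hA
    rcases hst.eq_or_lt with rfl | hlt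
    · exact le_rfl
    have hA' : ∀ r, s < r → MeasurableSet[G0 ℱ L hL r] A := by
      rw [h𝒢 s] at hA
      simp only [MeasurableSpace.measurableSet_iInf] at hA
      exact hA
    have h := hp.final hL hright hM h0 hlt hA'
    have hnn : ∀ r ω, 0 ≤ ZZ L p r ω * M r ω := fun r ω => mul_nonneg (ZZ_nonneg r ω) (h0 r ω)
    rw [← ofReal_integral_eq_lintegral_ofReal (hp.fin hL hM h0 _).integrableOn
        (Eventually.of_forall (hnn t)),
      ← ofReal_integral_eq_lintegral_ofReal (hp.fin hL hM h0 _).integrableOn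
        (Eventually.of_forall (hnn s))] at h
    exact (ENNReal.ofReal_le_ofReal_iff (integral_nonneg (hnn s))).1 h
end
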